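/- The sequence of ratios d(n+1)/d(n), taken over all positive integers n, is dense in the interval (0, ∞); that is, every positive real number is a limit point of the set {d(n+1)/d(n) : n a positive integer}. -/

import Mathlib

/-- `d n` is the number of positive divisors of `n`. -/
def d (n : ℕ) : ℕ := n.divisors.card

open ArithmeticFunction in
theorem exists_clone {G : ℕ} (hG : G ≠ 0) : ∀ Z : ℕ, 1 ≤ Z → ∃ R : ℕ, R ≠ 0 ∧
    (∀ s, (R ^ s).divisors.card = (G ^ s).divisors.card) ∧ cardFactors R = cardFactors G ∧
    ∀ p : ℕ, p.Prime → p ∣ R → Z < p ∧ p ≤ Z * 2 ^ cardFactors G := by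
  induction G using Nat.recOnPosPrimePosCoprime with
  | zero => exact absurd rfl hG
  | one =>
    intro Z _
    refine ⟨1, one_ne_zero, fun _ => rfl, rfl, fun p hp h => ?_⟩
    exact absurd (Nat.dvd_one.1 h) hp.one_lt.ne'
  | prime_pow p n hp hn =>
    intro Z hZ
    obtain ⟨q, hq, h1, h2⟩ := Nat.exists_prime_lt_and_le_two_mul Z (by omega)
    refine ⟨q ^ n, pow_ne_zero _ hq.ne_zero, fun s => ?_, ?_, fun r hr h => ?_⟩
    · rw [← pow_mul, ← pow_mul, Nat.divisors_prime_pow hq, Nat.divisors_prime_pow hp]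
      simp
    · rw [cardFactors_apply_prime_pow hq, cardFactors_apply_prime_pow hp]
    · rw [(Nat.prime_dvd_prime_iff_eq hr hq).1 (hr.dvd_of_dvd_pow h),
        cardFactors_apply_prime_pow hp]
      refine ⟨h1, h2.trans ?_⟩
      rw [mul_comm]
      exact Nat.mul_le_mul_left _ (Nat.le_self_pow hn.ne' 2)
  | coprime a b ha hb hab iha ihb =>
    intro Z hZ
    have ha0 : a ≠ 0 := by omega
    have hb0 : b ≠ 0 := by omega
    obtain ⟨R, hR0, hRd, hRc, hRp⟩ := iha ha0 Z hZ
    obtain ⟨S, hS0, hSd, hSc, hSp⟩ := ihb hb0 (Z * 2 ^ cardFactors a)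
      (Nat.mul_pos hZ (by positivity))
    have hRS : R.Coprime S := Nat.Coprime.symm <| Nat.coprime_of_dvd fun p hp h1 h2 =>
      absurd (hRp p hp h2).2 (not_le.2 (hSp p hp h1).1)
    refine ⟨R * S, mul_ne_zero hR0 hS0, fun s => ?_, ?_, fun p hp h => ?_⟩
    · rw [mul_pow, mul_pow, (hRS.pow s s).card_divisors_mul, (hab.pow s s).card_divisors_mul,
        hRd, hSd]
    · rw [cardFactors_mul hR0 hS0, cardFactors_mul ha0 hb0, hRc, hSc]
    · rw [cardFactors_mul ha0 hb0, pow_add, ← mul_assoc]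
      rcases (Nat.Prime.dvd_mul hp).1 h with h | h
      · exact ⟨(hRp p hp h).1, (hRp p hp h).2.trans (Nat.le_mul_of_pos_right _ (by positivity))⟩
      · exact ⟨(Nat.le_mul_of_pos_right _ (by positivity)).trans_lt (hSp p hp h).1,
          (hSp p hp h).2⟩

open ArithmeticFunction in
theorem exists_coprime_clones {ι : Type*} [DecidableEq ι] (G : ι → ℕ) (s : Finset ι)
    (hG : ∀ i ∈ s, G i ≠ 0) : ∀ Z : ℕ, 1 ≤ Z → ∃ R : ι → ℕ,
    (∀ i ∈ s, R i ≠ 0 ∧ (R i).divisors.card = (G i).divisors.card ∧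
      cardFactors (R i) = cardFactors (G i) ∧
      ∀ p : ℕ, p.Prime → p ∣ R i → Z < p ∧ p ≤ Z * 2 ^ ∑ i ∈ s, cardFactors (G i)) ∧
    ∀ i ∈ s, ∀ j ∈ s, i ≠ j → (R i).Coprime (R j) := by
  induction s using Finset.induction_on with
  | empty => intro Z _; exact ⟨fun _ => 1, by simp⟩
  | insert a s ha ih =>
    intro Z hZ
    obtain ⟨S, hS0, hSd, hSc, hSp⟩ := exists_clone (hG a (by simp)) Z hZ
    obtain ⟨R, hR, hRR⟩ := ih (fun i hi => hG i (by simp [hi])) (Z * 2 ^ cardFactors (G a))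
      (Nat.mul_pos hZ (by positivity))
    have hSR : ∀ i ∈ s, (R i).Coprime S := fun i hi => Nat.coprime_of_dvd fun p hp h1 h2 =>
      absurd (hSp p hp h2).2 (not_le.2 ((hR i hi).2.2.2 p hp h1).1)
    have hne : ∀ i ∈ s, i ≠ a := fun i hi h => ha (h ▸ hi)
    refine ⟨Function.update R a S, fun i hi => ?_, fun i hi j hj hij => ?_⟩
    · rw [Finset.sum_insert ha, pow_add, ← mul_assoc]
      rcases Finset.mem_insert.1 hi with rfl | hi
      · rw [Function.update_self]
        exact ⟨hS0, by simpa using hSd 1, hSc, fun p hp h => ⟨(hSp p hp h).1,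
          (hSp p hp h).2.trans (Nat.le_mul_of_pos_right _ (by positivity))⟩⟩
      · rw [Function.update_of_ne (hne i hi)]
        obtain ⟨h1, h2, h3, h4⟩ := hR i hi
        exact ⟨h1, h2, h3, fun p hp h => ⟨(Nat.le_mul_of_pos_right _ (by positivity)).trans_lt
          (h4 p hp h).1, (h4 p hp h).2⟩⟩
    · rcases Finset.mem_insert.1 hi with rfl | hi' <;> rcases Finset.mem_insert.1 hj with rfl | hj'
      · exact absurd rfl hij
      · rw [Function.update_self, Function.update_of_ne (hne j hj')]
        exact (hSR j hj').symm
      · rw [Function.update_self, Function.update_of_ne (hne i hi')]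
        exact hSR i hi'
      · rw [Function.update_of_ne (hne i hi'), Function.update_of_ne (hne j hj')]
        exact hRR i hi' j hj' hij

theorem le_pow_cardFactors {n B : ℕ} (hn : n ≠ 0) (h : ∀ p : ℕ, p.Prime → p ∣ n → p ≤ B) :
    n ≤ B ^ ArithmeticFunction.cardFactors n := by
  conv_lhs => rw [← Nat.prod_primeFactorsList hn]
  rw [ArithmeticFunction.cardFactors_apply]
  exact List.prod_le_pow_card _ _ fun p hp =>
    h p (Nat.prime_of_mem_primeFactorsList hp) (Nat.dvd_of_mem_primeFactorsList hp)

theorem two_pow_cardFactors_le {n : ℕ} (hn : n ≠ 0) :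
    2 ^ ArithmeticFunction.cardFactors n ≤ n := by
  conv_rhs => rw [← Nat.prod_primeFactorsList hn]
  rw [ArithmeticFunction.cardFactors_apply]
  exact List.pow_card_le_prod _ _ fun p hp => (Nat.prime_of_mem_primeFactorsList hp).two_le

theorem cardFactors_le_of_le_two_pow {n e : ℕ} (hn : n ≠ 0) (h : n ≤ 2 ^ e) :
    ArithmeticFunction.cardFactors n ≤ e :=
  (Nat.pow_le_pow_iff_right one_lt_two).1 ((two_pow_cardFactors_le hn).trans h)

theorem exists_base {x ε : ℝ} (hx : 0 < x) (hε : 0 < ε) : ∃ c : ℕ, ∀ k : ℕ, 1 ≤ k →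
    ∃ A B : ℕ, A ≠ 0 ∧ B ≠ 0 ∧ A.Coprime B ∧ 2 ∣ A ∧
      (∀ p : ℕ, p.Prime → p ≤ 8 * k → p ∣ A * B) ∧ A * B ≤ 2 ^ (c * k ^ 2) ∧
      ∀ s : ℕ, 1 ≤ s →
        |((A ^ s).divisors.card : ℝ) / (B ^ s).divisors.card - x| < ε := by
  obtain ⟨T, hT⟩ := exists_nat_gt (max (1 / x) ((2 + x) / ε))
  have hT1 : 1 / x < T := (le_max_left _ _).trans_lt hT
  have hT2 : (2 + x) / ε < T := (le_max_right _ _).trans_lt hT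
  have hT0 : (0 : ℝ) < T := lt_trans (by positivity) hT1
  have hT0' : 0 < T := by exact_mod_cast hT0
  set a := ⌊x * T⌋₊ with ha
  have ha1 : 1 ≤ a := by
    rw [ha, Nat.one_le_floor_iff]
    rw [div_lt_iff₀ hx] at hT1
    linarith
  have hfl : (a : ℝ) ≤ x * T := Nat.floor_le (by positivity)
  have hfl' : x * T < a + 1 := Nat.lt_floor_add_one _
  refine ⟨a + 2 * T + 400, fun k hk => ?_⟩
  set P := (Finset.range (8 * k + 1)).filter (fun p => p.Prime ∧ 3 < p) with hP
  set G := ∏ p ∈ P, p with hG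
  have hGp : ∀ p : ℕ, p.Prime → p ∣ G → 3 < p ∧ p ≤ 8 * k := by
    intro p hp h
    obtain ⟨q, hq, hpq⟩ := (Prime.dvd_finsetProd_iff hp.prime _).1 h
    rw [hP, Finset.mem_filter, Finset.mem_range] at hq
    rw [(Nat.prime_dvd_prime_iff_eq hp hq.2.1).1 hpq]
    exact ⟨hq.2.2, by omega⟩
  have hG0 : G ≠ 0 := Finset.prod_ne_zero_iff.2 fun p hp => by
    rw [hP, Finset.mem_filter] at hp
    exact hp.2.1.ne_zero
  have hGle : G ≤ 2 ^ (16 * k) := by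
    have h1 : G ∣ primorial (8 * k) :=
      Finset.prod_dvd_prod_of_subset _ _ _ fun p hp => by
        simp only [hP, Finset.mem_filter] at hp ⊢
        exact ⟨hp.1, hp.2.1⟩
    refine (Nat.le_of_dvd (primorial_pos _) h1).trans ((primorial_le_four_pow _).trans ?_)
    rw [show (4 : ℕ) = 2 ^ 2 by norm_num, ← pow_mul]
    exact Nat.pow_le_pow_right (by norm_num) (by omega)
  have hGc : ArithmeticFunction.cardFactors G ≤ 16 * k := cardFactors_le_of_le_two_pow hG0 hGle
  obtain ⟨R, hR0, hRd, hRc, hRp⟩ := exists_clone hG0 (8 * k) (by omega)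
  have hRle : R ≤ 2 ^ (384 * k ^ 2) := by
    refine (le_pow_cardFactors hR0 fun p hp h => (hRp p hp h).2).trans ?_
    have h1 : 8 * k * 2 ^ ArithmeticFunction.cardFactors G ≤ 2 ^ (24 * k) := by
      calc _ ≤ 2 ^ (8 * k) * 2 ^ (16 * k) :=
            Nat.mul_le_mul Nat.lt_two_pow_self.le (Nat.pow_le_pow_right (by norm_num) hGc)
        _ = _ := by rw [← pow_add]; congr 1; ring
    calc _ ≤ (2 ^ (24 * k)) ^ ArithmeticFunction.cardFactors R := Nat.pow_le_pow_left h1 _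
      _ ≤ (2 ^ (24 * k)) ^ (16 * k) := Nat.pow_le_pow_right (by positivity) (hRc ▸ hGc)
      _ = _ := by rw [← pow_mul]; congr 1; ring
  have c1 : (2 : ℕ).Coprime 3 := by norm_num
  have c2 : (2 : ℕ).Coprime R := (Nat.Prime.coprime_iff_not_dvd Nat.prime_two).2 fun h => by
    have := hRp 2 Nat.prime_two h; omega
  have c3 : (3 : ℕ).Coprime R := (Nat.Prime.coprime_iff_not_dvd Nat.prime_three).2 fun h => by
    have := hRp 3 Nat.prime_three h; omega
  have c4 : (2 : ℕ).Coprime G := (Nat.Prime.coprime_iff_not_dvd Nat.prime_two).2 fun h => by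
    have := hGp 2 Nat.prime_two h; omega
  have c5 : (3 : ℕ).Coprime G := (Nat.Prime.coprime_iff_not_dvd Nat.prime_three).2 fun h => by
    have := hGp 3 Nat.prime_three h; omega
  have c6 : G.Coprime R := Nat.coprime_of_dvd fun p hp h1 h2 => by
    have := hGp p hp h1; have := hRp p hp h2; omega
  refine ⟨2 ^ a * G, 3 ^ T * R, by positivity, by positivity, ?_, ?_, ?_, ?_, ?_⟩
  · exact Nat.Coprime.mul_left (Nat.Coprime.mul_right (c1.pow _ _) (c2.pow_left _))
      (Nat.Coprime.mul_right (c5.pow_left _).symm c6)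
  · exact Dvd.dvd.mul_right (dvd_pow_self 2 (by omega)) _
  · intro p hp hpk
    by_cases h3 : 3 < p
    · refine Dvd.dvd.mul_right (Dvd.dvd.mul_left (Finset.dvd_prod_of_mem (fun p => p) ?_) _) _
      rw [hP, Finset.mem_filter, Finset.mem_range]
      exact ⟨by omega, hp, h3⟩
    · have := hp.two_le
      obtain rfl | rfl : p = 2 ∨ p = 3 := by omega
      · exact Dvd.dvd.mul_right (Dvd.dvd.mul_right (dvd_pow_self 2 (by omega)) _) _
      · exact Dvd.dvd.mul_left (Dvd.dvd.mul_right (dvd_pow_self 3 (by omega)) _) _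
  · have h3 : 3 ^ T ≤ 2 ^ (2 * T) := by
      rw [pow_mul]; exact Nat.pow_le_pow_left (by norm_num) _
    calc 2 ^ a * G * (3 ^ T * R)
        ≤ 2 ^ a * 2 ^ (16 * k) * (2 ^ (2 * T) * 2 ^ (384 * k ^ 2)) := by gcongr
      _ = 2 ^ (a + 16 * k + (2 * T + 384 * k ^ 2)) := by simp only [pow_add]
      _ ≤ _ := by
        apply Nat.pow_le_pow_right (by norm_num)
        have : k ≤ k ^ 2 := Nat.le_self_pow (by norm_num) k
        have h4 : (a + 2 * T) * 1 ≤ (a + 2 * T) * k ^ 2 :=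
          Nat.mul_le_mul_left _ (Nat.one_le_pow _ _ hk)
        nlinarith
  · intro s hs
    have e1 : ((2 ^ a * G) ^ s).divisors.card = (a * s + 1) * (G ^ s).divisors.card := by
      rw [mul_pow, ((c4.pow_left a).pow s s).card_divisors_mul, ← pow_mul,
        Nat.divisors_prime_pow Nat.prime_two]
      simp
    have e2 : ((3 ^ T * R) ^ s).divisors.card = (T * s + 1) * (G ^ s).divisors.card := by
      rw [mul_pow, ((c3.pow_left T).pow s s).card_divisors_mul, ← pow_mul,
        Nat.divisors_prime_pow Nat.prime_three, hRd]
      simp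
    have hg : ((G ^ s).divisors.card : ℝ) ≠ 0 := by
      simp [hG0]
    rw [e1, e2]
    push_cast
    rw [mul_div_mul_right _ _ hg]
    have hs' : (1 : ℝ) ≤ s := by exact_mod_cast hs
    have hpos : (0 : ℝ) < T * s + 1 := by positivity
    rw [div_sub' hpos.ne', abs_div, abs_of_pos hpos, div_lt_iff₀ hpos]
    rw [div_lt_iff₀ hε] at hT2
    have h5 : (2 + x) * s < T * ε * s := by
      exact mul_lt_mul_of_pos_right hT2 (by linarith)
    rw [abs_lt]
    constructor <;> nlinarith [mul_le_mul_of_nonneg_right hfl (by linarith : (0 : ℝ) ≤ s),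
      mul_le_mul_of_nonneg_right hfl'.le (by linarith : (0 : ℝ) ≤ s),
      mul_le_mul_of_nonneg_left hs' hx.le]

theorem exists_not_modEq {p n : ℕ} (h : ℕ → ℕ) (hp : n < p) :
    ∃ r, ∀ i < n, ¬ r ≡ h i [MOD p] := by
  have hcard : ((Finset.range n).image fun i => h i % p).card < (Finset.range p).card :=
    Finset.card_image_le.trans_lt (by simpa using hp)
  obtain ⟨r, hr, hr'⟩ := Finset.exists_mem_notMem_of_card_lt_card hcard
  refine ⟨r, fun i hi h' => hr' (Finset.mem_image.2 ⟨i, Finset.mem_range.2 hi, ?_⟩)⟩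
  rw [← h', Nat.mod_eq_of_lt (Finset.mem_range.1 hr)]

theorem exists_shifts {M k : ℕ} (c : ℕ → ℕ) (hM : 2 ≤ M)
    (hk : ∀ p : ℕ, p.Prime → ¬ p ∣ M → k < p) (n : ℕ) (hn : n ≤ k) : ∃ h : ℕ → ℕ,
    (∀ i < n, h i ≡ c i [MOD M]) ∧ (∀ i j, i < j → j < n → h i < h j) ∧
    (∀ i < n, h i ≤ M ^ (k ^ 2 + 3) ^ n) ∧
    ∀ p : ℕ, p.Prime → ¬ p ∣ M → ∀ i j l m, i < j → j < n → l < m → m < n →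
      h i ≡ h j [MOD p] → h l ≡ h m [MOD p] → i = l ∧ j = m := by
  induction n with
  | zero => exact ⟨fun _ => 0, by simp⟩
  | succ n ih =>
    obtain ⟨h, hc, hlt, hle, hu⟩ := ih (by omega)
    set H := M ^ (k ^ 2 + 3) ^ n with hH
    have hMH : M ≤ H := Nat.le_self_pow (by positivity) M
    set T := (Finset.range n ×ˢ Finset.range n).filter (fun x => x.1 < x.2) with hT
    set D := ∏ x ∈ T, (h x.2 - h x.1) with hD
    have hTm : ∀ x, x ∈ T ↔ x.1 < x.2 ∧ x.2 < n := by
      intro x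
      simp only [hT, Finset.mem_filter, Finset.mem_product, Finset.mem_range]
      omega
    have hD0 : D ≠ 0 := Finset.prod_ne_zero_iff.2 fun x hx => by
      have := hlt _ _ ((hTm x).1 hx).1 ((hTm x).1 hx).2
      omega
    have hDle : D ≤ H ^ n ^ 2 := by
      refine (Finset.prod_le_pow_card T _ H fun x hx => ?_).trans ?_
      · exact (Nat.sub_le _ _).trans (hle _ ((hTm x).1 hx).2)
      · refine Nat.pow_le_pow_right (by omega) ((Finset.card_filter_le _ _).trans ?_)
        simp [sq]
    set S := D.primeFactors.filter (fun p => ¬ p ∣ M) with hS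
    have hSp : ∀ p ∈ S, p.Prime ∧ ¬ p ∣ M := fun p hp => by
      rw [hS, Finset.mem_filter] at hp
      exact ⟨Nat.prime_of_mem_primeFactors hp.1, hp.2⟩
    have hSmem : ∀ p : ℕ, p.Prime → ¬ p ∣ M → ∀ i j, i < j → j < n → h i ≡ h j [MOD p] →
        p ∈ S := by
      intro p hp hpM i j hij hj hm
      rw [hS, Finset.mem_filter, Nat.mem_primeFactors]
      refine ⟨⟨hp, ?_, hD0⟩, hpM⟩
      exact ((Nat.modEq_iff_dvd' (hlt i j hij hj).le).1 hm).trans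
        (Finset.dvd_prod_of_mem (fun x : ℕ × ℕ => h x.2 - h x.1) ((hTm (i, j)).2 ⟨hij, hj⟩))
    have hr : ∀ p : ℕ, ∃ r, p ∈ S → ∀ i < n, ¬ r ≡ h i [MOD p] := by
      intro p
      by_cases hp : p ∈ S
      · obtain ⟨r, hr⟩ := exists_not_modEq h
          (lt_of_lt_of_le (Nat.lt_succ_self n) (hn.trans (hk p (hSp p hp).1 (hSp p hp).2).le))
        exact ⟨r, fun _ => hr⟩
      · exact ⟨0, fun h => absurd h hp⟩
    choose r hr using hr
    obtain ⟨b, hb⟩ := Nat.chineseRemainderOfFinset r id S (fun p hp => (hSp p hp).1.ne_zero)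
      (fun p hp q hq hpq => (Nat.coprime_primes (hSp p hp).1 (hSp q hq).1).2 hpq)
    have hco : M.Coprime (∏ p ∈ S, p) := Nat.Coprime.prod_right fun p hp =>
      ((Nat.Prime.coprime_iff_not_dvd (hSp p hp).1).2 (hSp p hp).2).symm
    obtain ⟨b', hb'M, hb'S⟩ := Nat.chineseRemainder hco (c n) b
    set W := M * ∏ p ∈ S, p with hW
    have hSle : ∏ p ∈ S, p ≤ D :=
      Nat.le_of_dvd (Nat.pos_of_ne_zero hD0)
        ((Finset.prod_dvd_prod_of_subset _ _ _ (Finset.filter_subset _ _)).trans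
          (Nat.prod_primeFactors_dvd D))
    have hW0 : 0 < W := Nat.mul_pos (by omega)
      (Finset.prod_pos fun p hp => (hSp p hp).1.pos)
    set v := b' % W + W * (H + 1) with hv
    have hvW : v ≡ b' [MOD W] := by
      rw [hv, Nat.ModEq, Nat.add_mul_mod_self_left, Nat.mod_mod]
    have hvM : v ≡ c n [MOD M] := (hvW.of_dvd (dvd_mul_right _ _)).trans hb'M
    have hvS : ∀ p ∈ S, ∀ i < n, ¬ h i ≡ v [MOD p] := fun p hp i hi hiv => by
      have hpS : p ∣ ∏ p ∈ S, p := Finset.dvd_prod_of_mem (fun p => p) hp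
      exact hr p hp i hi ((hiv.trans ((hvW.of_dvd (hpS.mul_left M)).trans
        ((hb'S.of_dvd hpS).trans (hb p hp)))).symm)
    have hvlt : ∀ i < n, h i < v := fun i hi => by
      have := hle i hi
      nlinarith [Nat.zero_le (b' % W)]
    have hvle : v ≤ M ^ (k ^ 2 + 3) ^ (n + 1) := by
      have hH2 : 2 ≤ H := hM.trans hMH
      calc v ≤ W * (H + 2) := by
            have := Nat.mod_lt b' hW0
            rw [hv]; nlinarith
        _ ≤ (H * H ^ n ^ 2) * (H * H) :=
            Nat.mul_le_mul (Nat.mul_le_mul hMH (hSle.trans hDle)) (by nlinarith)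
        _ = H ^ (n ^ 2 + 3) := by ring
        _ ≤ H ^ (k ^ 2 + 3) := Nat.pow_le_pow_right (by omega)
            (by have : n ^ 2 ≤ k ^ 2 := Nat.pow_le_pow_left (by omega) 2
                omega)
        _ = _ := by rw [hH, ← pow_mul, ← pow_succ]
    have hHle : H ≤ M ^ (k ^ 2 + 3) ^ (n + 1) :=
      Nat.pow_le_pow_right (by omega) (Nat.pow_le_pow_right (by omega) (by omega))
    refine ⟨Function.update h n v, ?_, ?_, ?_, ?_⟩
    · intro i hi
      rcases Nat.lt_succ_iff_lt_or_eq.1 hi with hi | rfl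
      · rw [Function.update_of_ne hi.ne]; exact hc i hi
      · rw [Function.update_self]; exact hvM
    · intro i j hij hj
      rw [Function.update_of_ne (by omega : i ≠ n)]
      rcases Nat.lt_succ_iff_lt_or_eq.1 hj with hj | rfl
      · rw [Function.update_of_ne hj.ne]; exact hlt i j hij hj
      · rw [Function.update_self]; exact hvlt i hij
    · intro i hi
      rcases Nat.lt_succ_iff_lt_or_eq.1 hi with hi | rfl
      · rw [Function.update_of_ne hi.ne]; exact (hle i hi).trans hHle
      · rw [Function.update_self]; exact hvle
    · intro p hp hpM i j l m hij hj hlm hm h1 h2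
      rw [Function.update_of_ne (by omega : i ≠ n)] at h1
      rw [Function.update_of_ne (by omega : l ≠ n)] at h2
      rcases Nat.lt_succ_iff_lt_or_eq.1 hj with hj | rfl <;>
        rcases Nat.lt_succ_iff_lt_or_eq.1 hm with hm | rfl
      · rw [Function.update_of_ne hj.ne] at h1
        rw [Function.update_of_ne hm.ne] at h2
        exact hu p hp hpM i j l m hij hj hlm hm h1 h2
      · rw [Function.update_of_ne hj.ne] at h1
        rw [Function.update_self] at h2
        exact absurd h2 (hvS p (hSmem p hp hpM i j hij hj h1) l hlm)
      · rw [Function.update_self] at h1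
        rw [Function.update_of_ne hm.ne] at h2
        exact absurd h1 (hvS p (hSmem p hp hpM l m hlm hm h2) i hij)
      · rw [Function.update_self] at h1 h2
        refine ⟨?_, rfl⟩
        by_contra hil
        rcases Nat.lt_or_gt_of_ne hil with hil | hil
        · exact hvS p (hSmem p hp hpM i l hil hlm (h1.trans h2.symm)) i hij h1
        · exact hvS p (hSmem p hp hpM l i hil hij (h2.trans h1.symm)) l hlm h2

theorem card_divisors_prod {ι : Type*} (s : Finset ι) (f : ι → ℕ)
    (h : ∀ i ∈ s, ∀ j ∈ s, i ≠ j → (f i).Coprime (f j)) :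
    (∏ i ∈ s, f i).divisors.card = ∏ i ∈ s, (f i).divisors.card := by
  simpa [ArithmeticFunction.sigma_zero_apply] using
    (ArithmeticFunction.isMultiplicative_sigma (k := 0)).map_prod f s
      (fun i hi j hj hij => h i hi j hj hij)

theorem exists_shift_sub_eq {A B k i j a b : ℕ} (hAB : A.Coprime B) (hA : A ≠ 0) (hB : B ≠ 0)
    (hij : i < j) (hjk : j < k) (ha : a ≡ A ^ i * B ^ (k - i) [MOD (A * B) ^ (2 * k)])
    (hb : b ≡ A ^ j * B ^ (k - j) [MOD (A * B) ^ (2 * k)]) (hab : a < b) :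
    ∃ E, E ≠ 0 ∧ b = a + A ^ i * B ^ (k - j) * E ∧ E.Coprime (A * B) := by
  obtain ⟨s, rfl⟩ := Nat.exists_eq_add_of_lt hij
  obtain ⟨t, rfl⟩ := Nat.exists_eq_add_of_lt hjk
  have e1 : i + s + 1 + t + 1 - i = (s + 1) + (t + 1) := by omega
  have e2 : i + s + 1 + t + 1 - (i + s + 1) = t + 1 := by omega
  rw [e1] at ha
  rw [e2] at hb ⊢
  set k := i + s + 1 + t + 1 with hk
  set m := A ^ i * B ^ (t + 1) with hm
  have hm0 : m ≠ 0 := by positivity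
  have hmM : m ∣ (A * B) ^ k := by
    rw [mul_pow]
    exact mul_dvd_mul (pow_dvd_pow _ (by omega)) (pow_dvd_pow _ (by omega))
  have key : ∀ q, q ∣ (A * B) ^ (2 * k) → q ∣ b - a →
      (q : ℤ) ∣ m * ((A : ℤ) ^ (s + 1) - (B : ℤ) ^ (s + 1)) := by
    intro q hq hqd
    have h1 := (Nat.modEq_iff_dvd.1 (ha.of_dvd hq))
    have h2 := (Nat.modEq_iff_dvd.1 (hb.of_dvd hq))
    have h3 : (q : ℤ) ∣ (b : ℤ) - a := by
      have := Int.natCast_dvd_natCast.2 hqd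
      rwa [Nat.cast_sub hab.le] at this
    have h4 := (h3.add h2).sub h1
    have h5 : (m : ℤ) * ((A : ℤ) ^ (s + 1) - (B : ℤ) ^ (s + 1)) = (b : ℤ) - a +
        ((A ^ (i + s + 1) * B ^ (t + 1) : ℕ) - (b : ℤ)) -
          ((A ^ i * B ^ (s + 1 + (t + 1)) : ℕ) - (a : ℤ)) := by
      rw [hm]; push_cast; ring
    rw [h5]
    exact h4
  have hmd : m ∣ b - a := by
    rw [← Nat.modEq_iff_dvd' hab.le]
    have hmM' : m ∣ (A * B) ^ (2 * k) := hmM.trans (pow_dvd_pow _ (by omega))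
    have h1 : m ∣ A ^ i * B ^ (s + 1 + (t + 1)) :=
      mul_dvd_mul dvd_rfl (pow_dvd_pow _ (by omega))
    have h2 : m ∣ A ^ (i + s + 1) * B ^ (t + 1) :=
      mul_dvd_mul (pow_dvd_pow _ (by omega)) dvd_rfl
    exact ((ha.of_dvd hmM').trans (Nat.modEq_zero_iff_dvd.2 h1)).trans
      ((hb.of_dvd hmM').trans (Nat.modEq_zero_iff_dvd.2 h2)).symm
  obtain ⟨E, hE⟩ := hmd
  refine ⟨E, ?_, by omega, Nat.coprime_of_dvd fun p hp hpE hpAB => ?_⟩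
  · rintro rfl; omega
  · have h1 : m * p ∣ (A * B) ^ (2 * k) := by
      refine (mul_dvd_mul hmM hpAB).trans ?_
      rw [← pow_succ]; exact pow_dvd_pow _ (by omega)
    have h2 := key (m * p) h1 (hE ▸ mul_dvd_mul_left m hpE)
    push_cast at h2
    have h3 : (p : ℤ) ∣ (A : ℤ) ^ (s + 1) - (B : ℤ) ^ (s + 1) :=
      (mul_dvd_mul_iff_left (by exact_mod_cast hm0)).1 h2
    have hpi : Prime (p : ℤ) := Nat.prime_iff_prime_int.1 hp
    rcases (Nat.Prime.dvd_mul hp).1 hpAB with h | h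
    · have h4 : (p : ℤ) ∣ (A : ℤ) ^ (s + 1) :=
        dvd_pow (Int.natCast_dvd_natCast.2 h) (by omega)
      have h5 := hpi.dvd_of_dvd_pow ((dvd_sub_right h4).1 h3)
      exact hp.one_lt.ne' (Nat.dvd_one.1 (hAB ▸ Nat.dvd_gcd h (Int.natCast_dvd_natCast.1 h5)))
    · have h4 : (p : ℤ) ∣ (B : ℤ) ^ (s + 1) :=
        dvd_pow (Int.natCast_dvd_natCast.2 h) (by omega)
      have h5 := hpi.dvd_of_dvd_pow ((dvd_sub_left h4).1 h3)
      exact hp.one_lt.ne' (Nat.dvd_one.1 (hAB ▸ Nat.dvd_gcd (Int.natCast_dvd_natCast.1 h5) h))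

theorem exists_differences {A B k : ℕ} (hAB : A.Coprime B) (hA : A ≠ 0) (hB : B ≠ 0)
    (h : ℕ → ℕ) (hc : ∀ i < k, h i ≡ A ^ i * B ^ (k - i) [MOD (A * B) ^ (2 * k)])
    (hlt : ∀ i j, i < j → j < k → h i < h j)
    (hu : ∀ p : ℕ, p.Prime → ¬ p ∣ (A * B) ^ (2 * k) → ∀ i j l m, i < j → j < k → l < m →
      m < k → h i ≡ h j [MOD p] → h l ≡ h m [MOD p] → i = l ∧ j = m) :
    ∃ E : ℕ → ℕ → ℕ, (∀ i j, E i j = E j i) ∧ (∀ i, E i i = 1) ∧ (∀ i j, E i j ≠ 0) ∧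
      (∀ i j, (E i j).Coprime (A * B)) ∧ (∀ i j, k ≤ j → E i j = 1) ∧
      (∀ i j, i < j → j < k → h j = h i + A ^ i * B ^ (k - j) * E i j) ∧
      ∀ i j l m, i < j → j < k → l < m → m < k → (i, j) ≠ (l, m) →
        (E i j).Coprime (E l m) := by
  have ex : ∀ i j, ∃ E, E ≠ 0 ∧ E.Coprime (A * B) ∧ (k ≤ j → E = 1) ∧
      (i < j → j < k → h j = h i + A ^ i * B ^ (k - j) * E) := by
    intro i j
    by_cases hij : i < j ∧ j < k
    · obtain ⟨E, h1, h2, h3⟩ := exists_shift_sub_eq hAB hA hB hij.1 hij.2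
        (hc i (hij.1.trans hij.2)) (hc j hij.2) (hlt i j hij.1 hij.2)
      exact ⟨E, h1, h3, fun h => absurd hij.2 h.not_gt, fun _ _ => h2⟩
    · exact ⟨1, one_ne_zero, Nat.coprime_one_left _, fun _ => rfl, fun h1 h2 => absurd ⟨h1, h2⟩ hij⟩
  choose F hF0 hFc hF1 hF using ex
  have hmin : ∀ {i j : ℕ}, i < j → min i j = i ∧ max i j = j := fun hij =>
    ⟨min_eq_left hij.le, max_eq_right hij.le⟩
  refine ⟨fun i j => if i = j then 1 else F (min i j) (max i j), fun i j => ?_, fun i => if_pos rfl,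
    fun i j => ?_, fun i j => ?_, fun i j hj => ?_, fun i j hij hj => ?_, fun i j l m hij hj hlm hm hne => ?_⟩
  · simp only [eq_comm (a := i), min_comm i, max_comm i]
  · dsimp only; split_ifs
    · exact one_ne_zero
    · exact hF0 _ _
  · dsimp only; split_ifs
    · exact Nat.coprime_one_left _
    · exact hFc _ _
  · dsimp only; split_ifs
    · rfl
    · exact hF1 _ _ (le_max_of_le_right hj)
  · simp only [if_neg hij.ne, (hmin hij).1, (hmin hij).2]
    exact hF i j hij hj
  · simp only [if_neg hij.ne, if_neg hlm.ne, (hmin hij).1, (hmin hij).2, (hmin hlm).1,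
      (hmin hlm).2]
    refine Nat.coprime_of_dvd fun p hp h1 h2 => hne ?_
    have hpM : ¬ p ∣ (A * B) ^ (2 * k) := fun hd => hp.one_lt.ne' <| Nat.dvd_one.1 <|
      (hFc i j) ▸ Nat.dvd_gcd h1 (hp.dvd_of_dvd_pow hd)
    have key : ∀ {i j : ℕ}, i < j → j < k → p ∣ F i j → h i ≡ h j [MOD p] := by
      intro i j hij hj hd
      rw [hF i j hij hj]
      exact (Nat.modEq_iff_dvd' (Nat.le_add_right _ _)).2
        (by rw [Nat.add_sub_cancel_left]; exact hd.mul_left _)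
    obtain ⟨rfl, rfl⟩ := hu p hp hpM i j l m hij hj hlm hm (key hij hj h1) (key hlm hm h2)
    rfl

theorem exists_base_point {M k : ℕ} (hM : M ≠ 0) (h R : ℕ → ℕ) (E : ℕ → ℕ → ℕ)
    (T : Finset (ℕ × ℕ)) (hT : ∀ x, x ∈ T ↔ x.1 < x.2 ∧ x.2 < k)
    (hE0 : ∀ i j, E i j ≠ 0) (hR0 : ∀ l < k, R l ≠ 0)
    (hEE : ∀ x ∈ T, ∀ y ∈ T, x ≠ y → (E x.1 x.2).Coprime (E y.1 y.2))
    (hRR : ∀ l < k, ∀ m < k, l ≠ m → (R l).Coprime (R m))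
    (hEM : ∀ i j, (E i j).Coprime M) (hRM : ∀ l < k, (R l).Coprime M)
    (hER : ∀ i j, ∀ l < k, (E i j).Coprime (R l)) :
    ∃ x < (M * (∏ x ∈ T, E x.1 x.2) * ∏ l ∈ Finset.range k, R l) ^ 2,
      x ≡ 0 [MOD M ^ 2] ∧
      (∀ i j, i < j → j < k → ((E i j ^ 2 : ℕ) : ℤ) ∣ (x : ℤ) + 2 * h i - h j) ∧
      ∀ l < k, ((R l ^ 2 : ℕ) : ℤ) ∣ (x : ℤ) + h l - R l := by
  obtain ⟨y, hy⟩ := Nat.chineseRemainderOfFinset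
    (fun x : ℕ × ℕ => h x.2 + 2 * h x.1 * (E x.1 x.2 ^ 2 - 1)) (fun x => E x.1 x.2 ^ 2) T
    (fun x _ => pow_ne_zero _ (hE0 _ _))
    (fun x hx y hy hxy => (hEE x hx y hy hxy).pow 2 2)
  obtain ⟨z, hz⟩ := Nat.chineseRemainderOfFinset
    (fun l => R l + h l * (R l ^ 2 - 1)) (fun l => R l ^ 2) (Finset.range k)
    (fun l hl => pow_ne_zero _ (hR0 l (Finset.mem_range.1 hl)))
    (fun l hl m hm hlm =>
      (hRR l (by simpa using hl) m (by simpa using hm) hlm).pow 2 2)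
  have c1 : (M ^ 2).Coprime (∏ x ∈ T, E x.1 x.2 ^ 2) :=
    Nat.Coprime.prod_right fun x _ => ((hEM _ _).pow 2 2).symm
  obtain ⟨v, hvM, hvy⟩ := Nat.chineseRemainder c1 0 y
  have c2 : (M ^ 2 * ∏ x ∈ T, E x.1 x.2 ^ 2).Coprime (∏ l ∈ Finset.range k, R l ^ 2) :=
    Nat.Coprime.prod_right fun l hl => by
      have hl' := Finset.mem_range.1 hl
      exact Nat.Coprime.mul_left ((hRM l hl').pow 2 2).symm
        (Nat.Coprime.prod_left fun x _ => (hER _ _ l hl').pow 2 2)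
  obtain ⟨w, hwv, hwz⟩ := Nat.chineseRemainder c2 v z
  set Q := (M * (∏ x ∈ T, E x.1 x.2) * ∏ l ∈ Finset.range k, R l) ^ 2 with hQ
  have hQ' : Q = M ^ 2 * (∏ x ∈ T, E x.1 x.2 ^ 2) * ∏ l ∈ Finset.range k, R l ^ 2 := by
    rw [hQ, Finset.prod_pow, Finset.prod_pow]; ring
  have hQ0 : 0 < Q := Nat.pos_of_ne_zero <| pow_ne_zero _ <| mul_ne_zero (mul_ne_zero hM
    (Finset.prod_ne_zero_iff.2 fun x _ => hE0 _ _))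
    (Finset.prod_ne_zero_iff.2 fun l hl => hR0 l (Finset.mem_range.1 hl))
  have hwQ : w % Q ≡ w [MOD Q] := Nat.mod_modEq _ _
  rw [hQ'] at hwQ
  refine ⟨w % Q, Nat.mod_lt _ hQ0, ?_, fun i j hij hj => ?_, fun l hl => ?_⟩
  · rw [hQ']
    exact (((hwQ.of_dvd (dvd_mul_right _ _)).trans hwv).of_dvd (dvd_mul_right _ _)).trans hvM
  · have hmem : (i, j) ∈ T := (hT (i, j)).2 ⟨hij, hj⟩
    have h1 : w % Q ≡ y [MOD E i j ^ 2] := by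
      rw [hQ']
      exact ((((hwQ.of_dvd (dvd_mul_right _ _)).trans hwv).of_dvd (dvd_mul_left _ _)).trans
        hvy).of_dvd (Finset.dvd_prod_of_mem (fun x : ℕ × ℕ => E x.1 x.2 ^ 2) hmem)
    have h2 := Nat.modEq_iff_dvd.1 (h1.trans (hy _ hmem))
    have h3 : 1 ≤ E i j ^ 2 := Nat.one_le_iff_ne_zero.2 (pow_ne_zero _ (hE0 i j))
    push_cast [Nat.cast_sub h3] at h2 ⊢
    have h4 : ((w : ℤ) % Q) + 2 * h i - h j = 2 * h i * (E i j : ℤ) ^ 2 -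
      ((h j + 2 * h i * ((E i j : ℤ) ^ 2 - 1)) - (w : ℤ) % Q) := by ring
    rw [h4]
    exact (dvd_mul_left _ _).sub h2
  · have hmem : l ∈ Finset.range k := Finset.mem_range.2 hl
    have h1 : w % Q ≡ z [MOD R l ^ 2] := by
      rw [hQ']
      exact ((hwQ.of_dvd (dvd_mul_left _ _)).trans hwz).of_dvd
        (Finset.dvd_prod_of_mem (fun l => R l ^ 2) hmem)
    have h2 := Nat.modEq_iff_dvd.1 (h1.trans (hz _ hmem))
    have h3 : 1 ≤ R l ^ 2 := Nat.one_le_iff_ne_zero.2 (pow_ne_zero _ (hR0 l hl))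
    push_cast [Nat.cast_sub h3] at h2 ⊢
    have h4 : ((w : ℤ) % Q) + h l - R l = h l * (R l : ℤ) ^ 2 -
      ((R l + h l * ((R l : ℤ) ^ 2 - 1)) - (w : ℤ) % Q) := by ring
    rw [h4]
    exact (dvd_mul_left _ _).sub h2

theorem exists_local_factor {A B k H x : ℕ} {h R : ℕ → ℕ} {E : ℕ → ℕ → ℕ} (hA : A ≠ 0)
    (hB : B ≠ 0) (h2A : 2 ∣ A)
    (hc : ∀ i < k, h i ≡ A ^ i * B ^ (k - i) [MOD (A * B) ^ (2 * k)])
    (hlt : ∀ i j, i < j → j < k → h i < h j) (hH : ∀ i < k, h i ≤ H)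
    (hsymm : ∀ i j, E i j = E j i) (hone : ∀ i, E i i = 1) (hE0 : ∀ i j, E i j ≠ 0)
    (hEM : ∀ i j, (E i j).Coprime (A * B))
    (hE : ∀ i j, i < j → j < k → h j = h i + A ^ i * B ^ (k - j) * E i j)
    (hEE : ∀ i, ∀ j < k, ∀ l < k, i < k → j ≠ l → (E i j).Coprime (E i l))
    (hR0 : ∀ l < k, R l ≠ 0) (hRM : ∀ l < k, (R l).Coprime (A * B))
    (hER : ∀ i j, ∀ l < k, (E i j).Coprime (R l))
    (hRH : ∀ l < k, ∀ p : ℕ, p.Prime → p ∣ R l → H < p)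
    (hx : x ≡ 0 [MOD ((A * B) ^ k) ^ 2])
    (hxE : ∀ i j, i < j → j < k → ((E i j ^ 2 : ℕ) : ℤ) ∣ (x : ℤ) + 2 * h i - h j)
    (hxR : ∀ l < k, ((R l ^ 2 : ℕ) : ℤ) ∣ (x : ℤ) + h l - R l) {i : ℕ} (hi : i < k) :
    ∃ u, x + h i = A ^ i * B ^ (k - i) * (∏ j ∈ Finset.range k, E i j) * R i * u ∧
      (∀ p : ℕ, p.Prime → p ∣ A * B → ¬ p ∣ u) ∧
      (∀ p : ℕ, p.Prime → ∀ l m, l < m → m < k → p ∣ E l m → ¬ p ∣ u) ∧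
      ∀ p : ℕ, p.Prime → ∀ l < k, p ∣ R l → ¬ p ∣ u := by
  set c := A ^ i * B ^ (k - i) with hcdef
  have hc0 : c ≠ 0 := by positivity
  have hcM : c ∣ (A * B) ^ k := by
    rw [mul_pow]; exact mul_dvd_mul (pow_dvd_pow _ hi.le) (pow_dvd_pow _ (Nat.sub_le _ _))
  have hax : x + h i ≡ c [MOD (A * B) ^ (2 * k)] := by
    rw [mul_comm 2 k, pow_mul]
    have := hx.add (by simpa only [mul_comm 2 k, pow_mul] using hc i hi)
    simpa using this
  have hcop : ∀ p : ℕ, p.Prime → ∀ l m, p ∣ E l m → ¬ p ∣ A * B := fun p hp l m h1 h2 =>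
    hp.one_lt.ne' <| Nat.dvd_one.1 <| hEM l m ▸ Nat.dvd_gcd h1 h2
  have hcop' : ∀ p : ℕ, p.Prime → ∀ l m, p ∣ E l m → ∀ s t, ¬ p ∣ A ^ s * B ^ t := by
    intro p hp l m h1 s t h2
    refine hcop p hp l m h1 ?_
    rcases (Nat.Prime.dvd_mul hp).1 h2 with h2 | h2
    · exact (hp.dvd_of_dvd_pow h2).mul_right _
    · exact (hp.dvd_of_dvd_pow h2).mul_left _
  have hEd : ∀ j < k, E i j ∣ x + h i := by
    intro j hj
    rcases lt_trichotomy i j with hij | rfl | hij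
    · have h1 := (Int.natCast_dvd_natCast.2 (dvd_pow_self (E i j) two_ne_zero)).trans (hxE i j hij hj)
      have h2 : ((h j : ℕ) : ℤ) = h i + A ^ i * B ^ (k - j) * E i j := by
        exact_mod_cast hE i j hij hj
      rw [h2] at h1
      have h3 := h1.add (dvd_mul_left (E i j : ℤ) (A ^ i * B ^ (k - j)))
      have h4 : ((E i j : ℕ) : ℤ) ∣ ((x + h i : ℕ) : ℤ) := by
        push_cast; refine h3.trans (dvd_of_eq ?_); ring
      exact_mod_cast h4
    · rw [hone]; exact one_dvd _
    · rw [hsymm]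
      have h1 := (Int.natCast_dvd_natCast.2 (dvd_pow_self (E j i) two_ne_zero)).trans (hxE j i hij hi)
      have h2 : ((h i : ℕ) : ℤ) = h j + A ^ j * B ^ (k - i) * E j i := by
        exact_mod_cast hE j i hij hi
      have h3 := h1.add (dvd_mul_left (E j i : ℤ) (2 * (A ^ j * B ^ (k - i))))
      have h4 : ((E j i : ℕ) : ℤ) ∣ ((x + h i : ℕ) : ℤ) := by
        push_cast; refine h3.trans (dvd_of_eq ?_); rw [h2]; ring
      exact_mod_cast h4
  have hRd : R i ∣ x + h i := by
    have h1 := (Int.natCast_dvd_natCast.2 (dvd_pow_self (R i) two_ne_zero)).trans (hxR i hi)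
    have h2 : ((R i : ℕ) : ℤ) ∣ ((x + h i : ℕ) : ℤ) := by
      push_cast; simpa using h1.add (dvd_refl (R i : ℤ))
    exact_mod_cast h2
  have hcd : c ∣ x + h i :=
    (hax.dvd_iff (hcM.trans (pow_dvd_pow _ (by omega)))).2 dvd_rfl
  have hcAB : ∀ n : ℕ, n.Coprime (A * B) → n.Coprime c := fun n hn =>
    Nat.Coprime.mul_right ((Nat.Coprime.coprime_mul_right_right hn).pow_right _)
      ((Nat.Coprime.coprime_mul_left_right hn).pow_right _)
  have heM : (∏ j ∈ Finset.range k, E i j).Coprime c :=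
    Nat.Coprime.prod_left fun j _ => hcAB _ (hEM i j)
  have heR : (∏ j ∈ Finset.range k, E i j).Coprime (R i) :=
    Nat.Coprime.prod_left fun j _ => hER i j i hi
  have hed : (∏ j ∈ Finset.range k, E i j) ∣ x + h i := by
    refine Finset.prod_dvd_of_isRelPrime (fun j hj l hl hjl => ?_) fun j hj =>
      hEd j (Finset.mem_range.1 hj)
    exact Nat.coprime_iff_isRelPrime.1
      (hEE i j (by simpa using hj) l (by simpa using hl) hi hjl)
  obtain ⟨u, hu⟩ := Nat.Coprime.mul_dvd_of_dvd_of_dvd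
    (Nat.Coprime.mul_left (hcAB _ (hRM i hi)).symm heR)
    (Nat.Coprime.mul_dvd_of_dvd_of_dvd heM.symm hcd hed) hRd
  refine ⟨u, hu, fun p hp hpAB hpu => ?_, fun p hp l m hlm hm hpE hpu => ?_,
    fun p hp l hl hpR hpu => ?_⟩
  · have h1 : c * p ∣ x + h i := by
      rw [hu, mul_assoc c, mul_assoc c]
      exact mul_dvd_mul_left _ (hpu.mul_left _)
    have h2 : c * p ∣ (A * B) ^ (2 * k) := by
      refine (mul_dvd_mul hcM hpAB).trans ?_
      rw [← pow_succ]; exact pow_dvd_pow _ (by omega)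
    have h3 := (hax.dvd_iff h2).1 h1
    have h4 := Nat.le_of_dvd (Nat.pos_of_ne_zero hc0) h3
    nlinarith [hp.two_le, Nat.pos_of_ne_zero hc0]
  · have hEp : ∀ j < k, ((E i j * p : ℕ) : ℤ) ∣ ((x + h i : ℕ) : ℤ) := by
      intro j hj
      refine Int.natCast_dvd_natCast.2 ?_
      rw [hu]
      refine mul_dvd_mul (Dvd.dvd.mul_right (Dvd.dvd.mul_left ?_ _) _) hpu
      exact Finset.dvd_prod_of_mem (fun j => E i j) (Finset.mem_range.2 hj)
    have hl := hlm.trans hm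
    have hEcast : ((h m : ℕ) : ℤ) = h l + (A ^ l * B ^ (k - m) : ℕ) * E l m := by
      exact_mod_cast hE l m hlm hm
    have hsq : ((E l m * p : ℕ) : ℤ) ∣ (x : ℤ) + 2 * h l - h m := by
      refine (Int.natCast_dvd_natCast.2 ?_).trans (hxE l m hlm hm)
      rw [sq]; exact mul_dvd_mul_left _ hpE
    have hE0' : ((E l m : ℕ) : ℤ) ≠ 0 := by exact_mod_cast hE0 l m
    by_cases hil : i = l
    · subst hil
      have h1 := (hEp m hm).sub hsq
      have h2 : ((E i m * p : ℕ) : ℤ) ∣ (E i m : ℤ) * (A ^ i * B ^ (k - m) : ℕ) := by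
        refine h1.trans (dvd_of_eq ?_)
        rw [hEcast, Nat.cast_add]; ring
      rw [Nat.cast_mul, mul_dvd_mul_iff_left hE0'] at h2
      exact hcop' p hp i m hpE _ _ (Int.natCast_dvd_natCast.1 h2)
    by_cases him : i = m
    · subst him
      have h1 := hEp l hl
      rw [hsymm] at h1
      have h1 := h1.sub hsq
      have h2 : ((E l i * p : ℕ) : ℤ) ∣ (E l i : ℤ) * (2 * (A ^ l * B ^ (k - i)) : ℕ) := by
        refine h1.trans (dvd_of_eq ?_)
        rw [Nat.cast_add, hEcast]; push_cast; ring
      rw [Nat.cast_mul, mul_dvd_mul_iff_left hE0'] at h2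
      rcases (Nat.Prime.dvd_mul hp).1 (Int.natCast_dvd_natCast.1 h2) with h3 | h3
      · exact hcop p hp l i hpE (h3.trans (h2A.mul_right _))
      · exact hcop' p hp l i hpE _ _ h3
    · have h1 : (p : ℤ) ∣ (x : ℤ) + 2 * h l - h m :=
        (Int.natCast_dvd_natCast.2 (dvd_mul_left _ _)).trans hsq
      have h2 : (p : ℤ) ∣ (x : ℤ) + h i := by
        have := (Int.natCast_dvd_natCast.2 (dvd_mul_left p _)).trans (hEp m hm)
        exact_mod_cast this
      have h3 : (p : ℤ) ∣ (A ^ l * B ^ (k - m) : ℕ) * (E l m : ℤ) :=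
        (Int.natCast_dvd_natCast.2 hpE).mul_left _
      have h4 : (p : ℤ) ∣ (h i : ℤ) - h l := by
        have := (h2.sub h1).sub h3
        refine this.trans (dvd_of_eq ?_)
        rw [hEcast]; ring
      have h5 : p ∣ E l i := by
        rcases Nat.lt_or_gt_of_ne hil with hlt' | hlt'
        · rw [hE i l hlt' hl] at h4
          have h6 : (p : ℤ) ∣ ((A ^ i * B ^ (k - l) * E i l : ℕ) : ℤ) := by
            rw [← dvd_neg]; refine h4.trans (dvd_of_eq ?_); push_cast; ring
          rw [hsymm]
          exact ((Nat.Prime.dvd_mul hp).1 (Int.natCast_dvd_natCast.1 h6)).resolve_left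
            (hcop' p hp l m hpE _ _)
        · rw [hE l i hlt' hi] at h4
          have h6 : (p : ℤ) ∣ ((A ^ l * B ^ (k - i) * E l i : ℕ) : ℤ) := by
            refine h4.trans (dvd_of_eq ?_); push_cast; ring
          exact ((Nat.Prime.dvd_mul hp).1 (Int.natCast_dvd_natCast.1 h6)).resolve_left
            (hcop' p hp l m hpE _ _)
      exact hp.one_lt.ne' <| Nat.dvd_one.1 <|
        hEE l i hi m hm hl him ▸ Nat.dvd_gcd h5 hpE
  · by_cases hil : i = l
    · subst hil
      have h1 : ((R i * p : ℕ) : ℤ) ∣ ((x + h i : ℕ) : ℤ) := by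
        refine Int.natCast_dvd_natCast.2 ?_
        rw [hu]
        exact mul_dvd_mul (dvd_mul_left _ _) hpu
      have h2 : ((R i * p : ℕ) : ℤ) ∣ (x : ℤ) + h i - R i := by
        refine (Int.natCast_dvd_natCast.2 ?_).trans (hxR i hi)
        rw [sq]; exact mul_dvd_mul_left _ hpR
      have h3 : ((R i * p : ℕ) : ℤ) ∣ ((R i : ℕ) : ℤ) := by
        refine (h1.sub h2).trans (dvd_of_eq ?_); push_cast; ring
      have h4 := Nat.le_of_dvd (Nat.pos_of_ne_zero (hR0 i hi)) (Int.natCast_dvd_natCast.1 h3)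
      nlinarith [hp.two_le, Nat.pos_of_ne_zero (hR0 i hi)]
    · have h1 : (p : ℤ) ∣ (x : ℤ) + h l - R l := by
        refine (Int.natCast_dvd_natCast.2 ?_).trans (hxR l hl)
        exact hpR.trans (dvd_pow_self _ two_ne_zero)
      have h2 : (p : ℤ) ∣ ((x + h i : ℕ) : ℤ) :=
        Int.natCast_dvd_natCast.2 (hu ▸ hpu.mul_left _)
      have h3 : (p : ℤ) ∣ (h l : ℤ) - h i := by
        refine ((h1.add (Int.natCast_dvd_natCast.2 hpR)).sub h2).trans (dvd_of_eq ?_); push_cast; ring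
      have hpH := hRH l hl p hp hpR
      have hli := hH l hl
      have hii := hH i hi
      have hne : h i ≠ h l := by
        rcases Nat.lt_or_gt_of_ne hil with hh | hh
        · exact (hlt _ _ hh hl).ne
        · exact (hlt _ _ hh hi).ne'
      have h4 := Int.eq_zero_of_abs_lt_dvd h3 (by rw [abs_lt]; constructor <;> omega)
      omega

open ArithmeticFunction in
theorem exists_compensators {k : ℕ} (e : ℕ → ℕ) (he : ∀ i, e i ≠ 0) {H S : ℕ} (hH : 1 ≤ H)
    (hS : k * ∑ a ∈ Finset.range k, cardFactors (e a) ≤ S) :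
    ∃ (R : ℕ → ℕ) (F : ℕ), (∀ j < k, R j ≠ 0 ∧
      (R j).divisors.card * (e j).divisors.card = F ∧ ∀ p : ℕ, p.Prime → p ∣ R j → H < p) ∧
      (∀ i < k, ∀ j < k, i ≠ j → (R i).Coprime (R j)) ∧
      ∏ j ∈ Finset.range k, R j ≤ (H * 2 ^ S) ^ S := by
  set s := Finset.range k ×ˢ Finset.range k with hs
  set G : ℕ × ℕ → ℕ := fun x => if x.2 = x.1 then 1 else e x.2 with hG
  obtain ⟨R, hR, hRR⟩ := exists_coprime_clones G s
    (fun x _ => by simp only [hG]; split_ifs <;> simp [he]) H hH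
  have hΩ : ∑ x ∈ s, cardFactors (G x) ≤ S := by
    refine le_trans ?_ hS
    rw [hs, Finset.sum_product]
    refine (Finset.sum_le_card_nsmul _ _ _ fun j _ => Finset.sum_le_sum
      (g := fun a => cardFactors (e a)) fun a _ => ?_).trans (by simp)
    simp only [hG]; split_ifs <;> simp
  have hmem : ∀ {i a}, (i, a) ∈ s ↔ i < k ∧ a < k := by simp [hs]
  have hR0 : ∀ j < k, ∏ a ∈ Finset.range k, R (j, a) ≠ 0 := fun j hj =>
    Finset.prod_ne_zero_iff.2 fun a ha => (hR _ (hmem.2 ⟨hj, Finset.mem_range.1 ha⟩)).1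
  refine ⟨fun j => ∏ a ∈ Finset.range k, R (j, a),
    ∏ a ∈ Finset.range k, (e a).divisors.card, fun j hj => ⟨hR0 j hj, ?_, fun p hp hd => ?_⟩,
    fun i hi j hj hij => ?_, ?_⟩
  · rw [card_divisors_prod]
    · rw [Finset.prod_congr rfl fun a ha => (hR _ (hmem.2 ⟨hj, Finset.mem_range.1 ha⟩)).2.1,
        ← Finset.mul_prod_erase _ _ (Finset.mem_range.2 hj),
        ← Finset.mul_prod_erase _ (fun a => (e a).divisors.card) (Finset.mem_range.2 hj),
        mul_comm (e j).divisors.card]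
      simp only [hG, if_true, Nat.divisors_one, Finset.card_singleton, one_mul]
      congr 1
      exact Finset.prod_congr rfl fun a ha => by rw [if_neg (Finset.ne_of_mem_erase ha)]
    · intro a ha b hb hab
      exact hRR _ (hmem.2 ⟨hj, Finset.mem_range.1 ha⟩) _ (hmem.2 ⟨hj, Finset.mem_range.1 hb⟩)
        (by simpa using hab)
  · obtain ⟨a, ha, hd⟩ := (Prime.dvd_finsetProd_iff hp.prime _).1 hd
    exact ((hR _ (hmem.2 ⟨hj, Finset.mem_range.1 ha⟩)).2.2.2 p hp hd).1
  · refine Nat.Coprime.prod_left fun a ha => Nat.Coprime.prod_right fun b hb => ?_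
    exact hRR _ (hmem.2 ⟨hi, Finset.mem_range.1 ha⟩) _ (hmem.2 ⟨hj, Finset.mem_range.1 hb⟩)
      (by simp [hij])
  · rw [← Finset.prod_product (f := R), ← hs]
    calc ∏ x ∈ s, R x ≤ ∏ x ∈ s, (H * 2 ^ S) ^ cardFactors (G x) := by
          refine Finset.prod_le_prod' fun x hx => ?_
          obtain ⟨h0, -, h1, h2⟩ := hR x hx
          rw [← h1]
          exact le_pow_cardFactors h0 fun p hp hd => (h2 p hp hd).2.trans
            (Nat.mul_le_mul_left _ (Nat.pow_le_pow_right two_pos hΩ))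
      _ = (H * 2 ^ S) ^ ∑ x ∈ s, cardFactors (G x) := Finset.prod_pow_eq_pow_sum _ _ _
      _ ≤ (H * 2 ^ S) ^ S := Nat.pow_le_pow_right (by positivity) hΩ

theorem card_divisors_div_mul_eq {m a b E p q R R' F : ℕ} (hm : m ≠ 0) (hE : E ≠ 0)
    (hbp : b.Coprime p) (hbR : (b * p).Coprime R) (hEp : E.Coprime p)
    (haq : a.Coprime q) (haR : (a * q).Coprime R') (hEq : E.Coprime q)
    (hF : R.divisors.card * (E * p).divisors.card = F)
    (hF' : R'.divisors.card * (E * q).divisors.card = F) :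
    ((m * a) * (E * q) * R' / (m * E)).divisors.card * b.divisors.card =
      ((m * b) * (E * p) * R / (m * E)).divisors.card * a.divisors.card := by
  have hmE : 0 < m * E := by positivity
  rw [show (m * a) * (E * q) * R' = (m * E) * (a * q * R') by ring,
    show (m * b) * (E * p) * R = (m * E) * (b * p * R) by ring,
    Nat.mul_div_cancel_left _ hmE, Nat.mul_div_cancel_left _ hmE,
    Nat.Coprime.card_divisors_mul haR, Nat.Coprime.card_divisors_mul haq,
    Nat.Coprime.card_divisors_mul hbR, Nat.Coprime.card_divisors_mul hbp]
  rw [Nat.Coprime.card_divisors_mul hEp] at hF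
  rw [Nat.Coprime.card_divisors_mul hEq, ← hF] at hF'
  have h0 : 0 < E.divisors.card := Finset.card_pos.2 ⟨1, by simp [hE]⟩
  refine Nat.eq_of_mul_eq_mul_left h0 ?_
  linear_combination (a.divisors.card * b.divisors.card) * hF'

theorem exists_system {A B c k J : ℕ} (hk : 1 ≤ k) (hA : A ≠ 0) (hB : B ≠ 0)
    (hAB : A.Coprime B) (h2A : 2 ∣ A) (hp : ∀ p : ℕ, p.Prime → p ≤ 8 * k → p ∣ A * B)
    (hle : A * B ≤ 2 ^ (c * k ^ 2))
    (hJ : 8 * (k ^ 3 * (2 * c * k ^ 3 * (k ^ 2 + 3) ^ k)) ^ 2 ≤ J) :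
    ∃ (Q : ℕ) (a g u w : ℕ → ℕ), Q ≠ 0 ∧ Q ≤ 2 ^ J ∧
      (∀ i < k, 0 < a i ∧ a i = g i * u i ∧ Q = g i * w i ∧ a i ≤ 2 ^ (J + 1) ∧
        ∀ p : ℕ, p.Prime → p ∣ Q → p ∣ w i ∧ ¬ p ∣ u i) ∧
      (∀ p : ℕ, p.Prime → p ≤ 8 * k → p ∣ Q) ∧
      ∀ i j, i < j → j < k → ∃ s ≥ 1, a i < a j ∧ a j - a i ∣ g i ∧ a j - a i ∣ g j ∧
        (g j / (a j - a i)).divisors.card * (B ^ s).divisors.card =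
          (g i / (a j - a i)).divisors.card * (A ^ s).divisors.card := by
  set η := 2 * c * k ^ 3 * (k ^ 2 + 3) ^ k with hη
  set σ := k ^ 3 * η with hσ
  have hAB0 : A * B ≠ 0 := mul_ne_zero hA hB
  have hAB2 : 2 ≤ A * B := Nat.le_of_dvd (Nat.pos_of_ne_zero hAB0) (h2A.mul_right _)
  set M := (A * B) ^ (2 * k) with hM
  have hM2 : 2 ≤ M := hAB2.trans (Nat.le_self_pow (by omega) _)
  obtain ⟨h, hc, hlt, hhH, hu⟩ := exists_shifts (M := M) (k := k)
    (fun i => A ^ i * B ^ (k - i)) hM2 (fun p hpp hpM => by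
      by_contra hle
      exact hpM ((hp p hpp (by omega)).trans (dvd_pow_self _ (by omega)))) k le_rfl
  set H := M ^ (k ^ 2 + 3) ^ k with hH
  have hMH : M ≤ H := Nat.le_self_pow (by positivity) _
  have hHη : H ≤ 2 ^ η := by
    calc H ≤ ((2 ^ (c * k ^ 2)) ^ (2 * k)) ^ (k ^ 2 + 3) ^ k :=
          Nat.pow_le_pow_left (Nat.pow_le_pow_left hle _) _
      _ = 2 ^ η := by rw [← pow_mul, ← pow_mul, hη]; congr 1; ring
  obtain ⟨E, hsymm, hone, hE0, hEM, hEk, hE, hEE⟩ := exists_differences hAB hA hB h hc hlt hu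
  have hElt : ∀ i j, i < j → E i j ≤ H := by
    intro i j hij
    by_cases hj : j < k
    · refine le_trans ?_ (hhH j hj)
      rw [hE i j hij hj]
      exact (Nat.le_mul_of_pos_left _ (by positivity)).trans (Nat.le_add_left _ _)
    · rw [hEk i j (by omega)]; omega
  have hEH : ∀ i j, E i j ≤ H := by
    intro i j
    rcases lt_trichotomy i j with hij | rfl | hij
    · exact hElt i j hij
    · rw [hone]; omega
    · rw [hsymm]; exact hElt j i hij
  have hEE' : ∀ i, ∀ j < k, ∀ l < k, i < k → j ≠ l → (E i j).Coprime (E i l) := by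
    intro i j hj l hl hi hjl
    have key : ∀ j l, i ≠ j → i ≠ l → j < k → l < k → j ≠ l → (E i j).Coprime (E i l) := by
      intro j l hij hil hj hl hjl
      rcases Nat.lt_or_gt_of_ne hij with h1 | h1 <;> rcases Nat.lt_or_gt_of_ne hil with h2 | h2
      · exact hEE i j i l h1 hj h2 hl (by simp [hjl])
      · rw [hsymm i l]; exact hEE i j l i h1 hj h2 hi (by simp [hil])
      · rw [hsymm i j]; exact hEE j i i l h1 hi h2 hl (by simp [hil])
      · rw [hsymm i j, hsymm i l]; exact hEE j i l i h1 hi h2 hi (by simp [hjl])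
    by_cases hij : i = j
    · subst hij; rw [hone]; exact Nat.coprime_one_left _
    by_cases hil : i = l
    · subst hil; rw [hone]; exact Nat.coprime_one_right _
    exact key j l hij hil hj hl hjl
  set e : ℕ → ℕ := fun i => ∏ j ∈ Finset.range k, E i j with he
  have he0 : ∀ i, e i ≠ 0 := fun i => Finset.prod_ne_zero_iff.2 fun j _ => hE0 i j
  have heΩ : ∀ i, ArithmeticFunction.cardFactors (e i) ≤ η * k := by
    intro i
    refine cardFactors_le_of_le_two_pow (he0 i) ?_
    rw [pow_mul]
    refine (Finset.prod_le_pow_card _ _ _ fun j _ => (hEH i j).trans hHη).trans ?_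
    simp
  obtain ⟨R, F, hR, hRR, hRle⟩ := exists_compensators (k := k) (S := σ) e he0
    (show 1 ≤ H by omega) (by
      refine (Nat.mul_le_mul_left _ (Finset.sum_le_card_nsmul _ _ _ fun i _ => heΩ i)).trans ?_
      rw [Finset.card_range, smul_eq_mul, hσ]
      exact le_of_eq (by ring))
  have hcopH : ∀ n, n ≠ 0 → n ≤ H → ∀ l < k, n.Coprime (R l) := fun n hn hnH l hl =>
    Nat.coprime_of_dvd fun p hpp h1 h2 => by
      have := (hR l hl).2.2 p hpp h2
      have := Nat.le_of_dvd (Nat.pos_of_ne_zero hn) h1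
      omega
  have hABM : A * B ≤ M := Nat.le_self_pow (by omega) _
  have hRM : ∀ l < k, (R l).Coprime (A * B) := fun l hl =>
    (hcopH _ hAB0 (hABM.trans hMH) l hl).symm
  have hER : ∀ i j, ∀ l < k, (E i j).Coprime (R l) := fun i j => hcopH _ (hE0 i j) (hEH i j)
  set T := (Finset.range k ×ˢ Finset.range k).filter fun x => x.1 < x.2 with hT
  have hTm : ∀ x, x ∈ T ↔ x.1 < x.2 ∧ x.2 < k := by
    intro x; simp only [hT, Finset.mem_filter, Finset.mem_product, Finset.mem_range]; omega
  obtain ⟨x, hxQ, hx, hxE, hxR⟩ := exists_base_point (M := (A * B) ^ k) (k := k)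
    (pow_ne_zero _ hAB0) h R E T hTm hE0 (fun l hl => (hR l hl).1)
    (fun x hx y hy hxy => hEE _ _ _ _ ((hTm x).1 hx).1 ((hTm x).1 hx).2 ((hTm y).1 hy).1
      ((hTm y).1 hy).2 hxy) hRR (fun i j => (hEM i j).pow_right _)
    (fun l hl => (hRM l hl).pow_right _) hER
  set Q := (A * B) ^ k * (∏ x ∈ T, E x.1 x.2) * ∏ l ∈ Finset.range k, R l with hQ
  have hQ0 : Q ≠ 0 := mul_ne_zero (mul_ne_zero (pow_ne_zero _ hAB0)
    (Finset.prod_ne_zero_iff.2 fun x _ => hE0 _ _))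
    (Finset.prod_ne_zero_iff.2 fun l hl => (hR l (Finset.mem_range.1 hl)).1)
  have hη1 : 1 ≤ η := by
    by_contra h0
    have : η = 0 := by omega
    rw [this] at hHη
    omega
  have hησ : η * k ^ 2 ≤ σ := by
    rw [hσ, mul_comm]
    exact Nat.mul_le_mul_right _ (Nat.pow_le_pow_right hk (by norm_num))
  have hησ' : η ≤ σ := (Nat.le_mul_of_pos_right _ (by positivity)).trans hησ
  have hQle : Q ≤ 2 ^ (4 * σ ^ 2) := by
    have h1 : (A * B) ^ k ≤ 2 ^ η :=
      (Nat.pow_le_pow_right (by omega) (by omega)).trans (hMH.trans hHη)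
    have h2 : ∏ x ∈ T, E x.1 x.2 ≤ 2 ^ (η * k ^ 2) := by
      refine (Finset.prod_le_pow_card _ _ _ fun x _ => (hEH x.1 x.2).trans hHη).trans ?_
      rw [← pow_mul]
      refine Nat.pow_le_pow_right two_pos (Nat.mul_le_mul_left _ ?_)
      exact (Finset.card_filter_le _ _).trans (by simp [sq])
    have h3 : ∏ l ∈ Finset.range k, R l ≤ 2 ^ ((η + σ) * σ) := by
      refine hRle.trans ?_
      rw [pow_mul _ (η + σ), pow_add]
      exact Nat.pow_le_pow_left (Nat.mul_le_mul_right _ hHη) _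
    refine (Nat.mul_le_mul (Nat.mul_le_mul h1 h2) h3).trans ?_
    rw [← pow_add, ← pow_add]
    refine Nat.pow_le_pow_right two_pos ?_
    nlinarith
  have hQJ : Q ^ 2 ≤ 2 ^ J := by
    refine (Nat.pow_le_pow_left hQle 2).trans ?_
    rw [← pow_mul]
    exact Nat.pow_le_pow_right two_pos (by omega)
  have hηJ : η ≤ J := by nlinarith
  have loc := fun i (hi : i < k) => exists_local_factor hA hB h2A hc hlt hhH hsymm hone hE0 hEM hE
    hEE' (fun l hl => (hR l hl).1) hRM hER (fun l hl => (hR l hl).2.2) hx hxE hxR hi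
  choose! u hu1 hu2 hu3 hu4 using loc
  have hgQ : ∀ i < k, A ^ i * B ^ (k - i) * e i * R i ∣ Q := by
    intro i hi
    refine mul_dvd_mul (mul_dvd_mul ?_ ?_) (Finset.dvd_prod_of_mem _ (Finset.mem_range.2 hi))
    · rw [mul_pow]; exact mul_dvd_mul (pow_dvd_pow _ hi.le) (pow_dvd_pow _ (Nat.sub_le _ _))
    · refine Finset.prod_dvd_of_isRelPrime (fun j hj l hl hjl => ?_) fun j hj => ?_
      · exact Nat.coprime_iff_isRelPrime.1
          (hEE' i j (by simpa using hj) l (by simpa using hl) hi hjl)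
      · have hj := Finset.mem_range.1 hj
        rcases lt_trichotomy i j with hij | rfl | hij
        · exact Finset.dvd_prod_of_mem (fun x : ℕ × ℕ => E x.1 x.2) ((hTm (i, j)).2 ⟨hij, hj⟩)
        · rw [hone]; exact one_dvd _
        · rw [hsymm]
          exact Finset.dvd_prod_of_mem (fun x : ℕ × ℕ => E x.1 x.2) ((hTm (j, i)).2 ⟨hij, hi⟩)
  have huQ : ∀ i < k, ∀ p : ℕ, p.Prime → p ∣ Q → ¬ p ∣ u i := by
    intro i hi p hpp hpQ
    rcases (Nat.Prime.dvd_mul hpp).1 hpQ with h1 | h1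
    · rcases (Nat.Prime.dvd_mul hpp).1 h1 with h1 | h1
      · exact hu2 i hi p hpp (hpp.dvd_of_dvd_pow h1)
      · obtain ⟨x, hx, h1⟩ := (Prime.dvd_finsetProd_iff hpp.prime _).1 h1
        exact hu3 i hi p hpp _ _ ((hTm x).1 hx).1 ((hTm x).1 hx).2 h1
    · obtain ⟨l, hl, h1⟩ := (Prime.dvd_finsetProd_iff hpp.prime _).1 h1
      exact hu4 i hi p hpp l (Finset.mem_range.1 hl) h1
  have hpQ : ∀ p : ℕ, p.Prime → p ≤ 8 * k → p ∣ Q := fun p hpp hpk =>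
    (((hp p hpp hpk).trans (dvd_pow_self _ (by omega))).mul_right _).mul_right _
  refine ⟨Q ^ 2, fun i => x + h i, fun i => A ^ i * B ^ (k - i) * e i * R i, u,
    fun i => Q * (Q / (A ^ i * B ^ (k - i) * e i * R i)), pow_ne_zero _ hQ0, hQJ,
    fun i hi => ⟨?_, hu1 i hi, ?_, ?_, fun p hpp hd => ?_⟩, fun p hpp hpk =>
      (hpQ p hpp hpk).trans (dvd_pow_self _ two_ne_zero), fun i j hij hj => ?_⟩
  · have hu0 : u i ≠ 0 := fun h0 => huQ i hi 2 Nat.prime_two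
      (hpQ 2 Nat.prime_two (by omega)) (by simp [h0])
    have hg0 := ne_zero_of_dvd_ne_zero hQ0 (hgQ i hi)
    have := hu1 i hi
    dsimp only
    rw [this]
    exact Nat.pos_of_ne_zero (mul_ne_zero hg0 hu0)
  · dsimp only
    rw [mul_left_comm, Nat.mul_div_cancel' (hgQ i hi), sq]
  · have h1 := hhH i hi
    have h2 : 2 ^ η ≤ 2 ^ J := Nat.pow_le_pow_right two_pos hηJ
    dsimp only
    rw [pow_succ]
    omega
  · have hd := hpp.dvd_of_dvd_pow hd
    exact ⟨hd.mul_right _, huQ i hi p hpp hd⟩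
  · have hi := hij.trans hj
    have hD : x + h j - (x + h i) = A ^ i * B ^ (k - j) * E i j := by
      have := hE i j hij hj
      omega
    have hei : e i = E i j * ∏ l ∈ (Finset.range k).erase j, E i l :=
      (Finset.mul_prod_erase _ _ (Finset.mem_range.2 hj)).symm
    have hej : e j = E i j * ∏ l ∈ (Finset.range k).erase i, E j l := by
      rw [hsymm i j]; exact (Finset.mul_prod_erase _ _ (Finset.mem_range.2 hi)).symm
    have hAj : A ^ j * B ^ (k - j) = A ^ i * B ^ (k - j) * A ^ (j - i) := by
      rw [mul_right_comm, ← pow_add, Nat.add_sub_cancel' hij.le]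
    have hBi : A ^ i * B ^ (k - i) = A ^ i * B ^ (k - j) * B ^ (j - i) := by
      rw [mul_assoc, ← pow_add]; congr 2; omega
    refine ⟨j - i, by omega, by have := hlt i j hij hj; dsimp only; omega, ?_, ?_, ?_⟩
    · dsimp only
      rw [hD, hBi, hei]
      exact (mul_dvd_mul (dvd_mul_right _ _) (dvd_mul_right _ _)).mul_right _
    · dsimp only
      rw [hD, hAj, hej]
      exact (mul_dvd_mul (dvd_mul_right _ _) (dvd_mul_right _ _)).mul_right _
    · dsimp only
      rw [hD, hAj, hBi, hej, hei]
      have hA' : ∀ n : ℕ, n.Coprime (A * B) → ∀ t, (A ^ t).Coprime n := fun n hn t =>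
        (Nat.Coprime.coprime_mul_right_right hn).symm.pow_left _
      have hB' : ∀ n : ℕ, n.Coprime (A * B) → ∀ t, (B ^ t).Coprime n := fun n hn t =>
        (Nat.Coprime.coprime_mul_left_right hn).symm.pow_left _
      refine card_divisors_div_mul_eq (F := F) (by positivity) (hE0 i j) ?_ ?_ ?_ ?_ ?_ ?_ ?_ ?_
      · exact Nat.Coprime.prod_right fun l _ => hB' _ (hEM i l) _
      · exact Nat.Coprime.mul_left (hB' _ (hRM i hi) _)
          (Nat.Coprime.prod_left fun l _ => hER i l i hi)
      · exact Nat.Coprime.prod_right fun l hl => hEE' i j hj l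
          (Finset.mem_range.1 (Finset.mem_of_mem_erase hl)) hi (Finset.ne_of_mem_erase hl).symm
      · exact Nat.Coprime.prod_right fun l _ => hA' _ (hEM j l) _
      · exact Nat.Coprime.mul_left (hA' _ (hRM j hj) _)
          (Nat.Coprime.prod_left fun l _ => hER j l j hj)
      · rw [hsymm i j]
        exact Nat.Coprime.prod_right fun l hl => hEE' j i hi l
          (Finset.mem_range.1 (Finset.mem_of_mem_erase hl)) hj (Finset.ne_of_mem_erase hl).symm
      · rw [← hei]; exact (hR i hi).2.1
      · rw [← hej]; exact (hR j hj).2.1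

theorem abs_card_filter_dvd_linear_sub_le {q w : ℕ} (hq : q ≠ 0) (hw : w.Coprime q) (u X : ℕ) :
    |(((Finset.range X).filter fun m => q ∣ w * m + u).card : ℝ) - X / q| ≤ 1 := by
  obtain ⟨v, -, hv⟩ := Nat.exists_mul_mod_eq_of_coprime ((q - 1) * u) hw hq
  have hv : w * v + u ≡ 0 [MOD q] := by
    have h1 : w * v ≡ (q - 1) * u [MOD q] := hv
    refine (h1.add_right u).trans ((Nat.modEq_zero_iff_dvd).2 ⟨u, ?_⟩)
    obtain ⟨t, rfl⟩ := Nat.exists_eq_succ_of_ne_zero hq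
    simp [Nat.succ_mul]
  have hiff : ∀ m, q ∣ w * m + u ↔ m ≡ v [MOD q] := by
    intro m
    rw [← Nat.modEq_zero_iff_dvd]
    refine ⟨fun h => ?_, fun h => ((h.mul_left w).add_right u).trans hv⟩
    exact Nat.ModEq.cancel_left_of_coprime (Nat.coprime_comm.1 hw)
      (Nat.ModEq.add_right_cancel' u (h.trans hv.symm))
  simp only [hiff]
  rw [← Nat.count_eq_card_filter_range, Nat.count_modEq_card _ (Nat.pos_of_ne_zero hq)]
  have h1 : ((X / q : ℕ) : ℝ) ≤ X / q := Nat.cast_div_le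
  have h2 : (X : ℝ) / q < (X / q : ℕ) + 1 := by
    rw [div_lt_iff₀ (by positivity)]
    exact_mod_cast (Nat.lt_mul_div_succ X (Nat.pos_of_ne_zero hq)).trans_eq (mul_comm _ _)
  rw [abs_le]
  push_cast
  split_ifs <;> constructor <;> linarith

theorem sum_sq_card_filter_dvd_sub_le (P : Finset ℕ) (hP : ∀ p ∈ P, p.Prime) (X : ℕ) (L : ℕ → ℕ)
    (hL : ∀ q : ℕ, q ≠ 0 → (∀ p : ℕ, p.Prime → p ∣ q → p ∈ P) →
      |(((Finset.range X).filter fun m => q ∣ L m).card : ℝ) - X / q| ≤ 1) :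
    ∑ m ∈ Finset.range X, (((P.filter fun p => p ∣ L m).card : ℝ) - ∑ p ∈ P, (1 / p : ℝ)) ^ 2 ≤
      2 * (P.card : ℝ) ^ 2 + X * ∑ p ∈ P, (1 / p : ℝ) := by
  set f : ℕ → ℕ → ℝ := fun q m => if q ∣ L m then 1 else 0 with hf
  have hN : ∀ q, ∑ m ∈ Finset.range X, f q m =
      (((Finset.range X).filter fun m => q ∣ L m).card : ℝ) := fun q => by
    simp [hf, Finset.sum_boole]
  have hpair : ∀ p ∈ P, ∀ q ∈ P,
      ∑ m ∈ Finset.range X, (f p m - 1 / p) * (f q m - 1 / q) ≤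
        2 + if p = q then (X : ℝ) / p else 0 := by
    intro p hp q hq
    have hp2 : (2 : ℝ) ≤ p := by exact_mod_cast (hP p hp).two_le
    have hq2 : (2 : ℝ) ≤ q := by exact_mod_cast (hP q hq).two_le
    have hexp : ∑ m ∈ Finset.range X, (f p m - 1 / p) * (f q m - 1 / q) =
        ∑ m ∈ Finset.range X, f p m * f q m - (1 / q) * ∑ m ∈ Finset.range X, f p m -
          (1 / p) * ∑ m ∈ Finset.range X, f q m + X * (1 / p * (1 / q)) := by
      simp only [Finset.mul_sum, ← Finset.sum_sub_distrib]
      rw [← nsmul_eq_mul, ← Finset.card_range X, ← Finset.sum_const, Finset.card_range,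
        ← Finset.sum_add_distrib]
      exact Finset.sum_congr rfl fun m _ => by ring
    have h1 := abs_le.1 (hL p (hP p hp).ne_zero fun r hr hrp =>
      ((Nat.prime_dvd_prime_iff_eq hr (hP p hp)).1 hrp) ▸ hp)
    have h2 := abs_le.1 (hL q (hP q hq).ne_zero fun r hr hrp =>
      ((Nat.prime_dvd_prime_iff_eq hr (hP q hq)).1 hrp) ▸ hq)
    rw [← hN] at h1 h2
    have hpi : (1 : ℝ) / p ≤ 1 / 2 := one_div_le_one_div_of_le two_pos hp2
    have hqi : (1 : ℝ) / q ≤ 1 / 2 := one_div_le_one_div_of_le two_pos hq2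
    have hpi0 : (0 : ℝ) < 1 / p := by positivity
    have hqi0 : (0 : ℝ) < 1 / q := by positivity
    rw [hexp]
    by_cases hpq : p = q
    · subst hpq
      have hsq : ∑ m ∈ Finset.range X, f p m * f p m = ∑ m ∈ Finset.range X, f p m :=
        Finset.sum_congr rfl fun m _ => by simp only [hf]; split_ifs <;> simp
      rw [hsq, if_pos rfl]
      set S := ∑ m ∈ Finset.range X, f p m
      have hX : (X : ℝ) / p = X * (1 / p) := by ring
      rw [hX] at h1 ⊢
      have hX0 : (0 : ℝ) ≤ X := Nat.cast_nonneg _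
      nlinarith [mul_nonneg hX0 (mul_nonneg hpi0.le hpi0.le)]
    · have hcop := (Nat.coprime_primes (hP p hp) (hP q hq)).2 hpq
      have hmul : ∑ m ∈ Finset.range X, f p m * f q m = ∑ m ∈ Finset.range X, f (p * q) m :=
        Finset.sum_congr rfl fun m _ => by
          have hd : p * q ∣ L m ↔ p ∣ L m ∧ q ∣ L m :=
            ⟨fun h => ⟨(dvd_mul_right _ _).trans h, (dvd_mul_left _ _).trans h⟩,
              fun h => hcop.mul_dvd_of_dvd_of_dvd h.1 h.2⟩
          simp only [hf, hd]
          by_cases h1 : p ∣ L m <;> by_cases h2 : q ∣ L m <;> simp [h1, h2]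
      have h3 := abs_le.1 (hL (p * q) (mul_ne_zero (hP p hp).ne_zero (hP q hq).ne_zero)
        fun r hr hrpq => ?_)
      · rw [← hN] at h3
        rw [hmul, if_neg hpq]
        set S := ∑ m ∈ Finset.range X, f p m
        set S' := ∑ m ∈ Finset.range X, f q m
        have hX : (X : ℝ) / p = X * (1 / p) := by ring
        have hX' : (X : ℝ) / q = X * (1 / q) := by ring
        have hX'' : (X : ℝ) / (p * q : ℕ) = X * (1 / p * (1 / q)) := by
          push_cast; field_simp
        rw [hX] at h1; rw [hX'] at h2; rw [hX''] at h3
        nlinarith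
      · rcases (Nat.Prime.dvd_mul hr).1 hrpq with h | h
        · exact ((Nat.prime_dvd_prime_iff_eq hr (hP p hp)).1 h) ▸ hp
        · exact ((Nat.prime_dvd_prime_iff_eq hr (hP q hq)).1 h) ▸ hq
  have hsum : ∀ m, ((P.filter fun p => p ∣ L m).card : ℝ) - ∑ p ∈ P, (1 / p : ℝ) =
      ∑ p ∈ P, (f p m - 1 / p) := fun m => by
    rw [Finset.sum_sub_distrib]; simp [hf, Finset.sum_boole]
  simp only [hsum, sq, Finset.sum_mul_sum]
  rw [Finset.sum_comm]
  simp_rw [Finset.sum_comm (s := Finset.range X)]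
  refine (Finset.sum_le_sum fun p hp => Finset.sum_le_sum fun q hq => hpair p hp q hq).trans ?_
  simp only [Finset.sum_add_distrib, Finset.sum_ite_eq, Finset.sum_const, nsmul_eq_mul,
    Finset.mul_sum]
  refine le_of_eq ?_
  congr 1
  · ring
  · exact Finset.sum_congr rfl fun p hp => by rw [if_pos hp]; ring

theorem card_primes_Ioc_mul_le (j : ℕ) :
    ((Finset.Ioc (2 ^ j) (2 ^ (j + 1))).filter Nat.Prime).card * j ≤ 2 ^ (j + 2) := by
  set s := (Finset.Ioc (2 ^ j) (2 ^ (j + 1))).filter Nat.Prime with hs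
  have h1 : (2 ^ j) ^ s.card ≤ ∏ p ∈ s, p :=
    Finset.pow_card_le_prod _ _ _ fun p hp => by
      simp only [hs, Finset.mem_filter, Finset.mem_Ioc] at hp
      exact hp.1.1.le
  have h2 : ∏ p ∈ s, p ≤ primorial (2 ^ (j + 1)) := by
    refine Finset.prod_le_prod_of_subset_of_one_le' (fun p hp => ?_) fun p hp _ => ?_
    · simp only [hs, Finset.mem_filter, Finset.mem_Ioc] at hp
      simp only [Finset.mem_filter, Finset.mem_range]
      exact ⟨by omega, hp.2⟩
    · exact (Finset.mem_filter.1 hp).2.one_lt.le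
  have h3 := (h1.trans h2).trans (primorial_le_four_pow _)
  rw [show (4 : ℕ) = 2 ^ 2 by norm_num, ← pow_mul, ← pow_mul] at h3
  have h4 := (Nat.pow_le_pow_iff_right one_lt_two).1 h3
  rw [mul_comm, pow_succ 2 (j + 1)]
  omega

theorem sum_one_div_primes_Ioc_le (j : ℕ) :
    ∑ p ∈ (Finset.Ioc (2 ^ j) (2 ^ (j + 1))).filter Nat.Prime, (1 / p : ℝ) ≤ 8 / (j + 1) := by
  set s := (Finset.Ioc (2 ^ j) (2 ^ (j + 1))).filter Nat.Prime with hs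
  have h1 : ∑ p ∈ s, (1 / p : ℝ) ≤ s.card * (1 / 2 ^ j) := by
    rw [← nsmul_eq_mul]
    refine Finset.sum_le_card_nsmul _ _ _ fun p hp => ?_
    simp only [hs, Finset.mem_filter, Finset.mem_Ioc] at hp
    exact one_div_le_one_div_of_le (by positivity) (by exact_mod_cast hp.1.1.le)
  refine h1.trans ?_
  have h2 : (s.card : ℝ) * j ≤ 2 ^ (j + 2) := by exact_mod_cast card_primes_Ioc_mul_le j
  have h3 : (s.card : ℝ) ≤ 2 ^ j := by
    have : s.card ≤ 2 ^ j := by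
      refine (Finset.card_filter_le _ _).trans ?_
      rw [Nat.card_Ioc, pow_succ]; omega
    exact_mod_cast this
  rw [pow_add] at h2
  have h4 : (0 : ℝ) < 2 ^ j := by positivity
  rw [mul_one_div, div_le_div_iff₀ h4 (by positivity)]
  nlinarith

theorem sum_one_div_primes_le (T : ℕ) :
    ∑ p ∈ (Finset.Icc 1 (2 ^ T)).filter Nat.Prime, (1 / p : ℝ) ≤ 8 * (1 + Real.log T) := by
  have key : ∑ p ∈ (Finset.Icc 1 (2 ^ T)).filter Nat.Prime, (1 / p : ℝ) ≤
      8 * (harmonic T : ℝ) := by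
    induction T with
    | zero =>
      have : (Finset.Icc 1 (2 ^ 0)).filter Nat.Prime = ∅ := by decide
      rw [this]; simp
    | succ j ih =>
      have hu : Finset.Icc 1 (2 ^ (j + 1)) =
          Finset.Icc 1 (2 ^ j) ∪ Finset.Ioc (2 ^ j) (2 ^ (j + 1)) := by
        ext n
        have h1 : 2 ^ j ≤ 2 ^ (j + 1) := Nat.pow_le_pow_right two_pos (by omega)
        have h2 : 1 ≤ 2 ^ j := Nat.one_le_two_pow
        simp only [Finset.mem_union, Finset.mem_Icc, Finset.mem_Ioc]
        omega
      rw [hu, Finset.filter_union]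
      rw [Finset.sum_union, harmonic_succ]
      · have := sum_one_div_primes_Ioc_le j
        push_cast
        rw [mul_add, ← div_eq_mul_inv]
        exact add_le_add ih this
      · refine Finset.disjoint_filter_filter (Finset.disjoint_left.2 fun n h1 h2 => ?_)
        simp only [Finset.mem_Icc, Finset.mem_Ioc] at h1 h2
        omega
  exact key.trans (by linarith [harmonic_le_one_add_log T])

theorem card_filter_not_squarefree_le {w u k J T : ℕ} (hk : 1 ≤ k) (hkJ : k ≤ 2 ^ J)
    (hw : w ≤ 2 ^ J) (hu : u ≤ 2 ^ (J + 1)) (hT : 2 * J + 4 ≤ T)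
    (hsmall : ∀ p : ℕ, p.Prime → p ≤ 8 * k → ∀ m, ¬ p ∣ w * m + u)
    (hdvd : ∀ p : ℕ, p.Prime → ∀ m, p ∣ w * m + u → ¬ p ∣ w) :
    (((Finset.range (4 ^ T)).filter fun m => ¬ Squarefree (w * m + u)).card : ℝ) ≤
      4 ^ T / (4 * k) := by
  set X := 4 ^ T with hX
  set Y := 2 ^ (J + T + 1) with hY
  set S := (Finset.Ioc (8 * k) Y).filter fun p => p.Prime ∧ ¬ p ∣ w with hS
  have hX2 : X = 2 ^ T * 2 ^ T := by rw [hX, ← mul_pow]; norm_num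
  have hYe : Y = 2 * (2 ^ J * 2 ^ T) := by rw [hY]; ring
  have h16 : 16 * (2 ^ J * 2 ^ J) ≤ 2 ^ T := by
    calc 16 * (2 ^ J * 2 ^ J) = 2 ^ (2 * J + 4) := by ring
      _ ≤ 2 ^ T := Nat.pow_le_pow_right two_pos hT
  have hJ1 : 1 ≤ 2 ^ J := Nat.one_le_two_pow
  have hT1 : 1 ≤ 2 ^ T := Nat.one_le_two_pow
  rw [pow_succ] at hu
  have hsub : ((Finset.range X).filter fun m => ¬ Squarefree (w * m + u)) ⊆
      S.biUnion fun p => (Finset.range X).filter fun m => p ^ 2 ∣ w * m + u := by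
    intro m hm
    rw [Finset.mem_filter, Finset.mem_range, Nat.squarefree_iff_prime_squarefree] at hm
    obtain ⟨hmX, hm⟩ := hm
    push Not at hm
    obtain ⟨p, hp, hpm⟩ := hm
    have hpm1 : p ∣ w * m + u := (dvd_mul_right _ _).trans hpm
    have h0 : w * m + u ≠ 0 := fun h0 =>
      hsmall 2 Nat.prime_two (by omega) m (h0 ▸ dvd_zero _)
    have hpY : p ≤ Y := by
      refine Nat.mul_self_le_mul_self_iff.1 ((Nat.le_of_dvd (Nat.pos_of_ne_zero h0) hpm).trans ?_)
      have h1 : w * m ≤ 2 ^ J * X := Nat.mul_le_mul hw hmX.le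
      have h2 : Y * Y = 4 * (2 ^ J * (2 ^ J * X)) := by rw [hYe, hX2]; ring
      have h3 : 2 ^ J * X ≤ 2 ^ J * (2 ^ J * X) := Nat.le_mul_of_pos_left _ hJ1
      have h4 : 2 ^ J ≤ 2 ^ J * X := Nat.le_mul_of_pos_right _ (by positivity)
      omega
    simp only [hS, Finset.mem_biUnion, Finset.mem_filter, Finset.mem_Ioc, Finset.mem_range]
    exact ⟨p, ⟨⟨not_le.1 fun hle => hsmall p hp hle m hpm1, hpY⟩, hp, hdvd p hp m hpm1⟩, hmX,
      by rwa [sq]⟩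
  have h1 : (((Finset.range X).filter fun m => ¬ Squarefree (w * m + u)).card : ℝ) ≤
      ∑ p ∈ S, (X * ((p : ℝ) ^ 2)⁻¹ + 1) := by
    have := (Finset.card_le_card hsub).trans Finset.card_biUnion_le
    refine (Nat.cast_le (α := ℝ).2 this).trans ?_
    rw [Nat.cast_sum]
    refine Finset.sum_le_sum fun p hp => ?_
    simp only [hS, Finset.mem_filter] at hp
    have h2 := (abs_le.1 (abs_card_filter_dvd_linear_sub_le (q := p ^ 2) (w := w)
      (pow_ne_zero _ hp.2.1.ne_zero)
      (((Nat.Prime.coprime_iff_not_dvd hp.2.1).2 hp.2.2).symm.pow_right 2) u X)).2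
    rw [Nat.cast_pow p, div_eq_mul_inv] at h2
    linarith
  have h8 : 8 * k ≤ Y := by nlinarith
  have h2 : ∑ p ∈ S, (X * ((p : ℝ) ^ 2)⁻¹ + 1) ≤ X * ((8 * k : ℕ) : ℝ)⁻¹ + Y := by
    refine (Finset.sum_le_sum_of_subset_of_nonneg (Finset.filter_subset _ _)
      fun p _ _ => by positivity).trans ?_
    rw [Finset.sum_add_distrib, ← Finset.mul_sum, Finset.sum_const, Nat.card_Ioc, nsmul_eq_mul,
      mul_one]
    refine add_le_add (mul_le_mul_of_nonneg_left ?_ (Nat.cast_nonneg _))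
      (Nat.cast_le.2 (Nat.sub_le _ _))
    refine (sum_Ioc_inv_sq_le_sub (by omega) h8).trans ?_
    have : (0 : ℝ) ≤ (Y : ℝ)⁻¹ := by positivity
    linarith
  have h3 : (Y : ℝ) ≤ X * ((8 * k : ℕ) : ℝ)⁻¹ := by
    rw [← div_eq_mul_inv, le_div_iff₀ (by positivity)]
    have : Y * (8 * k) ≤ X := by
      calc Y * (8 * k) ≤ Y * (8 * 2 ^ J) := by gcongr
        _ = 16 * (2 ^ J * 2 ^ J) * 2 ^ T := by rw [hYe]; ring
        _ ≤ X := by rw [hX2]; exact Nat.mul_le_mul_right _ h16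
    exact_mod_cast this
  have h4 : (4 : ℝ) ^ T / (4 * k) = X * ((8 * k : ℕ) : ℝ)⁻¹ + X * ((8 * k : ℕ) : ℝ)⁻¹ := by
    rw [hX]; push_cast; field_simp; norm_num
  rw [h4]
  linarith

theorem exists_squarefree_values {k J T : ℕ} (w u : ℕ → ℕ) (hk : 1 ≤ k) (hkJ : k ≤ 2 ^ J)
    (hT : 2 * J + 4 ≤ T) (hw : ∀ i < k, w i ≤ 2 ^ J) (hu : ∀ i < k, u i ≤ 2 ^ (J + 1))
    (hsmall : ∀ i < k, ∀ p : ℕ, p.Prime → p ≤ 8 * k → ∀ m, ¬ p ∣ w i * m + u i)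
    (hdvd : ∀ i < k, ∀ p : ℕ, p.Prime → ∀ m, p ∣ w i * m + u i → ¬ p ∣ w i)
    (P : Finset ℕ) (hP : ∀ p ∈ P, p.Prime) (hPw : ∀ p ∈ P, ∀ i < k, ¬ p ∣ w i)
    (hPc : P.card ≤ 2 ^ T) :
    ∃ m < 4 ^ T, (∀ i < k, Squarefree (w i * m + u i)) ∧
      ∑ i ∈ Finset.range k,
        (((P.filter fun p => p ∣ w i * m + u i).card : ℝ) - ∑ p ∈ P, (1 / p : ℝ)) ^ 2 <
          2 * k * (∑ p ∈ P, (1 / p : ℝ) + 2) := by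
  set μ := ∑ p ∈ P, (1 / p : ℝ) with hμ
  have hμ0 : 0 ≤ μ := Finset.sum_nonneg fun p _ => by positivity
  set X := 4 ^ T with hX
  set v : ℕ → ℕ → ℝ := fun i m => (((P.filter fun p => p ∣ w i * m + u i).card : ℝ) - μ) ^ 2
    with hv
  set good := (Finset.range X).filter fun m => ∀ i < k, Squarefree (w i * m + u i) with hgood
  have hk0 : (0 : ℝ) < k := by exact_mod_cast hk
  have hX0 : (0 : ℝ) < X := by rw [hX]; positivity
  have hcard : (3 / 4 : ℝ) * X ≤ good.card := by
    have h1 : Finset.range X ⊆ good ∪ (Finset.range k).biUnion fun i =>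
        (Finset.range X).filter fun m => ¬ Squarefree (w i * m + u i) := by
      intro m hm
      by_cases h : ∀ i < k, Squarefree (w i * m + u i)
      · exact Finset.mem_union_left _ (Finset.mem_filter.2 ⟨hm, h⟩)
      · push Not at h
        obtain ⟨i, hi, h⟩ := h
        exact Finset.mem_union_right _ (Finset.mem_biUnion.2
          ⟨i, Finset.mem_range.2 hi, Finset.mem_filter.2 ⟨hm, h⟩⟩)
    have h2 := (Finset.card_le_card h1).trans ((Finset.card_union_le _ _).trans
      (Nat.add_le_add_left Finset.card_biUnion_le _))
    rw [Finset.card_range] at h2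
    have h3 : (X : ℝ) ≤ good.card + ∑ i ∈ Finset.range k,
        (((Finset.range X).filter fun m => ¬ Squarefree (w i * m + u i)).card : ℝ) := by
      exact_mod_cast h2
    have h4 := Finset.sum_le_card_nsmul (Finset.range k)
      (fun i => (((Finset.range X).filter fun m => ¬ Squarefree (w i * m + u i)).card : ℝ))
      (4 ^ T / (4 * k)) fun i hi => by
        have hi := Finset.mem_range.1 hi
        exact card_filter_not_squarefree_le hk hkJ (hw i hi) (hu i hi) hT (hsmall i hi) (hdvd i hi)
    have h5 : k • ((4 : ℝ) ^ T / (4 * k)) = X / 4 := by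
      rw [nsmul_eq_mul, hX]; push_cast; field_simp
    rw [Finset.card_range, h5] at h4
    linarith
  have htot : ∑ m ∈ Finset.range X, ∑ i ∈ Finset.range k, v i m ≤ k * (X * (μ + 2)) := by
    rw [Finset.sum_comm, ← nsmul_eq_mul]
    refine (Finset.sum_le_card_nsmul _ _ (X * (μ + 2)) fun i hi => ?_).trans_eq
      (by rw [Finset.card_range])
    have hi := Finset.mem_range.1 hi
    refine (sum_sq_card_filter_dvd_sub_le P hP X _ fun q hq hqP =>
      abs_card_filter_dvd_linear_sub_le hq ?_ _ _).trans ?_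
    · refine Nat.coprime_of_dvd fun p hp h1 h2 => hPw p (hqP p hp h2) i hi h1
    · have h1 : (P.card : ℝ) ≤ 2 ^ T := by exact_mod_cast hPc
      have h2 : ((2 : ℝ) ^ T) ^ 2 = X := by
        rw [hX, ← pow_mul, mul_comm, pow_mul]; norm_num
      have h3 : (P.card : ℝ) ^ 2 ≤ X := h2 ▸ pow_le_pow_left₀ (Nat.cast_nonneg _) h1 2
      rw [← hμ]
      linarith
  by_contra hno
  push Not at hno
  have h1 : (good.card : ℝ) * (2 * k * (μ + 2)) ≤ ∑ m ∈ good, ∑ i ∈ Finset.range k, v i m := by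
    rw [← nsmul_eq_mul]
    exact Finset.card_nsmul_le_sum _ _ _ fun m hm => hno m
      (Finset.mem_range.1 (Finset.mem_filter.1 hm).1) (Finset.mem_filter.1 hm).2
  have h2 : ∑ m ∈ good, ∑ i ∈ Finset.range k, v i m ≤
      ∑ m ∈ Finset.range X, ∑ i ∈ Finset.range k, v i m :=
    Finset.sum_le_sum_of_subset_of_nonneg (Finset.filter_subset _ _) fun m _ _ =>
      Finset.sum_nonneg fun i _ => sq_nonneg _
  have h3 : 0 < k * (X * (μ + 2)) := by positivity
  have h4 : (3 / 4 : ℝ) * X * (2 * k * (μ + 2)) ≤ good.card * (2 * k * (μ + 2)) :=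
    mul_le_mul_of_nonneg_right hcard (by positivity)
  nlinarith

theorem exists_lt_add_eq_of_sum_sq_lt {k : ℕ} {μ : ℝ} (hμ : 0 ≤ μ) (v e : ℕ → ℕ)
    (he : ∀ i < k, e i ≤ 3)
    (hsum : ∑ i ∈ Finset.range k, ((v i : ℝ) - μ) ^ 2 < 2 * k * (μ + 2))
    (hk : 4 < 3 / 4 * (k : ℝ)) (hμk : 32 * (μ + 2) < (3 / 4 * (k : ℝ) - 4) ^ 2) :
    ∃ i j, i < j ∧ j < k ∧ v i + e i = v j + e j := by
  set ρ := √(8 * (μ + 2)) with hρ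
  have hρ2 : ρ ^ 2 = 8 * (μ + 2) := Real.sq_sqrt (by linarith)
  have hρ0 : 0 ≤ ρ := Real.sqrt_nonneg _
  have hρk : 2 * ρ < 3 / 4 * (k : ℝ) - 4 :=
    lt_of_pow_lt_pow_left₀ 2 (by linarith) (by rw [mul_pow, hρ2]; linarith)
  set s := (Finset.range k).filter fun i => |(v i : ℝ) - μ| ≤ ρ with hs
  set t := (Finset.range k).filter fun i => ¬ |(v i : ℝ) - μ| ≤ ρ with ht
  have hst : (s.card : ℝ) + t.card = k := by
    have := Finset.card_filter_add_card_filter_not (s := Finset.range k)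
      (fun i => |(v i : ℝ) - μ| ≤ ρ)
    rw [Finset.card_range] at this
    exact_mod_cast this
  have htc : (t.card : ℝ) * ρ ^ 2 < 2 * k * (μ + 2) := by
    refine lt_of_le_of_lt ?_ hsum
    rw [← nsmul_eq_mul]
    refine (Finset.card_nsmul_le_sum t (fun i => ((v i : ℝ) - μ) ^ 2) _ fun i hi => ?_).trans
      (Finset.sum_le_sum_of_subset_of_nonneg (Finset.filter_subset _ _) fun i _ _ => sq_nonneg _)
    rw [← sq_abs ((v i : ℝ) - μ)]
    exact pow_le_pow_left₀ hρ0 (not_le.1 (Finset.mem_filter.1 hi).2).le 2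
  have htc' : (t.card : ℝ) < k / 4 := by
    rw [hρ2] at htc
    have : (0 : ℝ) < μ + 2 := by linarith
    nlinarith
  have hmaps : ∀ i ∈ s, v i + e i ∈ Finset.Icc ⌈μ - ρ⌉₊ ⌊μ + ρ + 3⌋₊ := by
    intro i hi
    have hi := Finset.mem_filter.1 hi
    have h1 := abs_le.1 hi.2
    have h2 : (e i : ℝ) ≤ 3 := by exact_mod_cast he i (Finset.mem_range.1 hi.1)
    have h3 : (0 : ℝ) ≤ e i := Nat.cast_nonneg _
    rw [Finset.mem_Icc]
    constructor
    · exact Nat.ceil_le.2 (by push_cast; linarith)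
    · exact Nat.le_floor (by push_cast; linarith)
  have hcard : (Finset.Icc ⌈μ - ρ⌉₊ ⌊μ + ρ + 3⌋₊).card < s.card := by
    rw [Nat.card_Icc]
    have h1 := Nat.le_ceil (μ - ρ)
    have h2 := Nat.floor_le (show 0 ≤ μ + ρ + 3 by linarith)
    rw [← Nat.cast_lt (α := ℝ)]
    rcases le_total ⌈μ - ρ⌉₊ (⌊μ + ρ + 3⌋₊ + 1) with h | h
    · rw [Nat.cast_sub h]; push_cast; linarith
    · rw [Nat.sub_eq_zero_of_le h]; push_cast; linarith
  obtain ⟨i, hi, j, hj, hij, heq⟩ := Finset.exists_ne_map_eq_of_card_lt_of_maps_to hcard hmaps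
  have hi := Finset.mem_range.1 (Finset.mem_filter.1 hi).1
  have hj := Finset.mem_range.1 (Finset.mem_filter.1 hj).1
  rcases Nat.lt_or_gt_of_ne hij with h | h
  · exact ⟨i, j, h, hj, heq⟩
  · exact ⟨j, i, h, hi, heq.symm⟩

theorem card_divisors_of_squarefree {n : ℕ} (hn : Squarefree n) :
    n.divisors.card = 2 ^ n.primeFactors.card := by
  rw [Nat.card_divisors hn.ne_zero, Finset.prod_congr rfl fun p hp => ?_, Finset.prod_const]
  rw [Nat.factorization_eq_one_of_squarefree hn (Nat.prime_of_mem_primeFactors hp)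
    (Nat.dvd_of_mem_primeFactors hp)]

theorem card_large_primeFactors_le {n w u m J T : ℕ} (hn : n = w * m + u) (hn0 : n ≠ 0)
    (hT : 2 * J + 4 ≤ T) (hw : w ≤ 2 ^ J) (hu : u ≤ 2 ^ (J + 1)) (hm : m < 4 ^ T) :
    (n.primeFactors.filter fun p => ¬ p ≤ 2 ^ T).card ≤ 3 := by
  by_contra h
  replace h := not_le.1 h
  have h1 : (2 ^ T) ^ (n.primeFactors.filter fun p => ¬ p ≤ 2 ^ T).card ≤ n := by
    refine (Finset.pow_card_le_prod _ (fun p => p) _ fun p hp =>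
      (not_le.1 (Finset.mem_filter.1 hp).2).le).trans ?_
    refine Nat.le_of_dvd (Nat.pos_of_ne_zero hn0) ?_
    exact (Finset.prod_dvd_prod_of_subset _ _ _ (Finset.filter_subset _ _)).trans
      (Nat.prod_primeFactors_dvd n)
  have h2 : (2 ^ T) ^ 4 ≤ n := (Nat.pow_le_pow_right Nat.one_le_two_pow h).trans h1
  have h16 : 16 * (2 ^ J * 2 ^ J) ≤ 2 ^ T := by
    calc 16 * (2 ^ J * 2 ^ J) = 2 ^ (2 * J + 4) := by ring
      _ ≤ 2 ^ T := Nat.pow_le_pow_right two_pos hT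
  have hX : 4 ^ T = 2 ^ T * 2 ^ T := by rw [← mul_pow]; norm_num
  have hJ1 : 1 ≤ 2 ^ J := Nat.one_le_two_pow
  have hT1 : 1 ≤ 2 ^ T := Nat.one_le_two_pow
  have h3 : w * m ≤ 2 ^ J * 4 ^ T := Nat.mul_le_mul hw hm.le
  rw [pow_succ] at hu
  rw [hX] at h3
  have h4 : 4 * 2 ^ J ≤ 2 ^ T := by nlinarith
  have h5 : 2 ^ J ≤ 2 ^ J * (2 ^ T * 2 ^ T) := Nat.le_mul_of_pos_right _ (by positivity)
  have h6 : 4 * 2 ^ J * (2 ^ T * 2 ^ T) ≤ 2 ^ T * (2 ^ T * 2 ^ T) := Nat.mul_le_mul_right _ h4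
  have h7 : 2 ^ T * (2 ^ T * 2 ^ T) ≤ 2 ^ T * (2 ^ T * (2 ^ T * 2 ^ T)) :=
    Nat.mul_le_mul_left _ (Nat.le_mul_of_pos_left _ (by positivity))
  have h8 : (2 ^ T) ^ 4 = 2 ^ T * (2 ^ T * (2 ^ T * 2 ^ T)) := by ring
  have h9 : 4 * 2 ^ J * (2 ^ T * 2 ^ T) = 4 * (2 ^ J * (2 ^ T * 2 ^ T)) := by ring
  omega

theorem exists_pair_card_divisors_eq {k J T Q : ℕ} (w u : ℕ → ℕ) (hkJ : k ≤ 2 ^ J)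
    (hT : 2 * J + 4 ≤ T) (hw : ∀ i < k, w i ≤ 2 ^ J) (hu : ∀ i < k, u i ≤ 2 ^ (J + 1))
    (hwQ : ∀ i < k, w i ∣ Q) (hQ : ∀ i < k, ∀ p : ℕ, p.Prime → p ∣ Q → p ∣ w i ∧ ¬ p ∣ u i)
    (hsmall : ∀ p : ℕ, p.Prime → p ≤ 8 * k → p ∣ Q) (hk : 4 < 3 / 4 * (k : ℝ))
    (hkT : 32 * (8 * (1 + Real.log T) + 2) < (3 / 4 * (k : ℝ) - 4) ^ 2) :
    ∃ m i j, i < j ∧ j < k ∧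
      (w i * m + u i).divisors.card = (w j * m + u j).divisors.card := by
  have hk1 : 1 ≤ k := by
    by_contra h
    rw [show k = 0 by omega] at hk
    norm_num at hk
  have hLQ : ∀ i < k, ∀ p : ℕ, p.Prime → p ∣ Q → ∀ m, ¬ p ∣ w i * m + u i :=
    fun i hi p hp hpQ m hd =>
      (hQ i hi p hp hpQ).2 ((Nat.dvd_add_right ((hQ i hi p hp hpQ).1.mul_right m)).1 hd)
  set P := (Finset.Icc 1 (2 ^ T)).filter fun p => p.Prime ∧ ¬ p ∣ Q with hP
  obtain ⟨m, hm, hsq, hsum⟩ := exists_squarefree_values w u hk1 hkJ hT hw hu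
    (fun i hi p hp hpk => hLQ i hi p hp (hsmall p hp hpk))
    (fun i hi p hp m hd hpw => hLQ i hi p hp (hpw.trans (hwQ i hi)) m hd) P
    (fun p hp => (Finset.mem_filter.1 hp).2.1)
    (fun p hp i hi hpw => (Finset.mem_filter.1 hp).2.2 (hpw.trans (hwQ i hi)))
    ((Finset.card_filter_le _ _).trans (by simp))
  set μ := ∑ p ∈ P, (1 / p : ℝ) with hμ
  have hμT : μ ≤ 8 * (1 + Real.log T) := by
    refine le_trans ?_ (sum_one_div_primes_le T)
    refine Finset.sum_le_sum_of_subset_of_nonneg (fun p hp => ?_) fun p _ _ => by positivity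
    simp only [hP, Finset.mem_filter] at hp ⊢
    exact ⟨hp.1, hp.2.1⟩
  obtain ⟨i, j, hij, hj, heq⟩ := exists_lt_add_eq_of_sum_sq_lt
    (Finset.sum_nonneg fun p _ => by positivity)
    (fun i => (P.filter fun p => p ∣ w i * m + u i).card)
    (fun i => ((w i * m + u i).primeFactors.filter fun p => ¬ p ≤ 2 ^ T).card)
    (fun i hi => card_large_primeFactors_le rfl (hsq i hi).ne_zero hT (hw i hi) (hu i hi) hm)
    hsum hk (by linarith)
  have hcard : ∀ i < k, (P.filter fun p => p ∣ w i * m + u i).card +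
      ((w i * m + u i).primeFactors.filter fun p => ¬ p ≤ 2 ^ T).card =
        (w i * m + u i).primeFactors.card := by
    intro i hi
    rw [← Finset.card_filter_add_card_filter_not (s := (w i * m + u i).primeFactors)
      fun p => p ≤ 2 ^ T]
    congr 2
    ext p
    simp only [hP, Finset.mem_filter, Finset.mem_Icc, Nat.mem_primeFactors]
    exact ⟨fun h => ⟨⟨h.1.2.1, h.2, (hsq i hi).ne_zero⟩, h.1.1.2⟩, fun h =>
      ⟨⟨⟨h.1.1.one_lt.le, h.2⟩, h.1.1, fun hpQ => hLQ i hi p h.1.1 hpQ m h.1.2.1⟩, h.1.2.1⟩⟩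
  refine ⟨m, i, j, hij, hj, ?_⟩
  rw [card_divisors_of_squarefree (hsq i (hij.trans hj)), card_divisors_of_squarefree (hsq j hj),
    ← hcard i (hij.trans hj), ← hcard j hj, heq]

theorem exists_large_parameter (c : ℕ) :
    ∃ k : ℕ, 1 ≤ k ∧ 4 < 3 / 4 * (k : ℝ) ∧
      32 * (8 * (1 + Real.log ((2 * (8 * (k ^ 3 * (2 * c * k ^ 3 * (k ^ 2 + 3) ^ k)) ^ 2 + k) + 4 :
        ℕ) : ℝ)) + 2) < (3 / 4 * (k : ℝ) - 4) ^ 2 := by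
  have hlog : ∀ᶠ k : ℕ in Filter.atTop, Real.log (2 * k) ≤ 1 / 2 ^ 15 * (2 * k) := by
    have h1 := Real.isLittleO_log_id_atTop.def (show (0 : ℝ) < 1 / 2 ^ 15 by positivity)
    have h2 : Filter.Tendsto (fun k : ℕ => (2 : ℝ) * k) Filter.atTop Filter.atTop :=
      tendsto_natCast_atTop_atTop.const_mul_atTop two_pos
    filter_upwards [h2.eventually h1] with k hk
    simp only [id, Real.norm_eq_abs, abs_of_nonneg (show (0 : ℝ) ≤ 2 * k by positivity)] at hk
    exact (le_abs_self _).trans hk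
  set C := Real.log (64 * c ^ 2 + 2) with hC
  have hC0 : 0 ≤ C := Real.log_nonneg (by nlinarith [sq_nonneg (c : ℝ)])
  have hlarge : ∀ᶠ k : ℕ in Filter.atTop, 2560 + 2048 * C < k :=
    tendsto_natCast_atTop_atTop.eventually_gt_atTop _
  obtain ⟨k, hk1, hk2⟩ := (hlog.and hlarge).exists
  have hk : (2560 : ℝ) < k := by linarith
  have hkN : 1 ≤ k := by
    have : (1 : ℝ) ≤ k := by linarith
    exact_mod_cast this
  refine ⟨k, hkN, by linarith, ?_⟩
  set T := 2 * (8 * (k ^ 3 * (2 * c * k ^ 3 * (k ^ 2 + 3) ^ k)) ^ 2 + k) + 4 with hT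
  have hTle : T ≤ (64 * c ^ 2 + 2) * (k ^ 2 + 3) ^ (2 * k + 6) := by
    have h1 : (k ^ 2) ^ 6 ≤ (k ^ 2 + 3) ^ 6 := Nat.pow_le_pow_left (by omega) 6
    have h2 : k ^ 2 + 3 ≤ (k ^ 2 + 3) ^ (2 * k + 6) := Nat.le_self_pow (by omega) _
    have h3 : k ≤ k ^ 2 := Nat.le_self_pow two_ne_zero k
    calc T = 64 * c ^ 2 * ((k ^ 2) ^ 6 * (k ^ 2 + 3) ^ (2 * k)) + (2 * k + 4) := by
          rw [hT]; ring
      _ ≤ 64 * c ^ 2 * ((k ^ 2 + 3) ^ 6 * (k ^ 2 + 3) ^ (2 * k)) +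
          2 * (k ^ 2 + 3) ^ (2 * k + 6) := by gcongr; omega
      _ = (64 * c ^ 2 + 2) * (k ^ 2 + 3) ^ (2 * k + 6) := by rw [pow_add]; ring
  have hlogT : Real.log T ≤ C + 8 * k * (2 * Real.log (2 * k)) := by
    have hy : Real.log ((k : ℝ) ^ 2 + 3) ≤ 2 * Real.log (2 * k) := by
      have h1 : Real.log ((2 * k : ℝ) ^ 2) = 2 * Real.log (2 * k) := by
        rw [Real.log_pow]; norm_num
      rw [← h1]
      exact Real.log_le_log (by positivity) (by nlinarith)
    have hy0 : 0 ≤ Real.log ((k : ℝ) ^ 2 + 3) := Real.log_nonneg (by nlinarith)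
    have h1 : (T : ℝ) ≤ (64 * c ^ 2 + 2) * ((k : ℝ) ^ 2 + 3) ^ (2 * k + 6) := by
      exact_mod_cast hTle
    have hT0 : (0 : ℝ) < T := by
      have : 0 < T := by omega
      exact_mod_cast this
    refine (Real.log_le_log hT0 h1).trans ?_
    rw [Real.log_mul (by positivity) (by positivity), Real.log_pow]
    push_cast
    have h2 : (2 * k + 6 : ℝ) * Real.log ((k : ℝ) ^ 2 + 3) ≤
        8 * k * Real.log ((k : ℝ) ^ 2 + 3) :=
      mul_le_mul_of_nonneg_right (by linarith) hy0
    have h3 : 8 * (k : ℝ) * Real.log ((k : ℝ) ^ 2 + 3) ≤ 8 * k * (2 * Real.log (2 * k)) :=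
      mul_le_mul_of_nonneg_left hy (by positivity)
    linarith
  have h4 : 8 * (k : ℝ) * (2 * Real.log (2 * k)) ≤ 8 * k * (2 * (1 / 2 ^ 15 * (2 * k))) := by
    gcongr
  have h5 : 8 * (k : ℝ) * (2 * (1 / 2 ^ 15 * (2 * k))) = k ^ 2 / 2 ^ 10 := by ring
  have h6 : (k : ℝ) ≤ k ^ 2 := by nlinarith
  nlinarith

theorem exists_abs_card_divisors_div_sub_lt {x ε : ℝ} (hx : 0 < x) (hε : 0 < ε) :
    ∃ n : ℕ, 0 < n ∧ |((n + 1).divisors.card : ℝ) / n.divisors.card - x| < ε := by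
  obtain ⟨c, hc⟩ := exists_base hx hε
  obtain ⟨k, hk, hk4, hkT⟩ := exists_large_parameter c
  obtain ⟨A, B, hA, hB, hAB, h2A, hp, hle, hs⟩ := hc k hk
  set J := 8 * (k ^ 3 * (2 * c * k ^ 3 * (k ^ 2 + 3) ^ k)) ^ 2 + k with hJ
  obtain ⟨Q, a, g, u, w, hQ0, hQJ, hform, hsmall, hpair⟩ :=
    exists_system (J := J) hk hA hB hAB h2A hp hle (Nat.le_add_right _ _)
  have hg0 : ∀ i < k, g i ≠ 0 := fun i hi h0 => hQ0 (by rw [(hform i hi).2.2.1, h0, zero_mul])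
  have hwQ : ∀ i < k, w i ∣ Q := fun i hi => ⟨g i, by rw [mul_comm, ← (hform i hi).2.2.1]⟩
  have hgQ : ∀ i < k, g i ∣ Q := fun i hi => ⟨w i, (hform i hi).2.2.1⟩
  obtain ⟨m, i, j, hij, hj, heq⟩ := exists_pair_card_divisors_eq (J := J) (Q := Q) w u
    ((Nat.le_add_left _ _).trans (Nat.lt_two_pow_self (n := J)).le) le_rfl
    (fun i hi => (Nat.le_of_dvd (Nat.pos_of_ne_zero hQ0) (hwQ i hi)).trans hQJ)
    (fun i hi => ((Nat.le_mul_of_pos_left _ (Nat.pos_of_ne_zero (hg0 i hi))).trans_eq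
      (hform i hi).2.1.symm).trans (hform i hi).2.2.2.1) hwQ
    (fun i hi => (hform i hi).2.2.2.2) hsmall hk4 hkT
  have hi := hij.trans hj
  obtain ⟨s, hs1, haij, hDi, hDj, hratio⟩ := hpair i j hij hj
  set D := a j - a i with hD
  have hD0 : 0 < D := by omega
  have hcop : ∀ l < k, ∀ t, t ∣ g l → t.Coprime (w l * m + u l) := fun l hl t ht =>
    Nat.coprime_of_dvd fun p hpp h1 h2 => by
      have h3 := (hform l hl).2.2.2.2 p hpp (h1.trans (ht.trans (hgQ l hl)))
      exact h3.2 ((Nat.dvd_add_right (h3.1.mul_right m)).1 h2)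
  have hval : ∀ l < k, D ∣ g l → a l + Q * m = D * (g l / D * (w l * m + u l)) := by
    intro l hl hDl
    rw [← mul_assoc, Nat.mul_div_cancel' hDl]
    conv_lhs => rw [(hform l hl).2.1, (hform l hl).2.2.1]
    ring
  have hsucc : g j / D * (w j * m + u j) = g i / D * (w i * m + u i) + 1 := by
    refine Nat.eq_of_mul_eq_mul_left hD0 ?_
    rw [← hval j hj hDj, Nat.mul_succ, ← hval i hi hDi]
    omega
  have hpos : 0 < g i / D * (w i * m + u i) := by
    have h1 := hval i hi hDi
    have h2 := (hform i hi).1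
    by_contra h0
    rw [show g i / D * (w i * m + u i) = 0 by omega] at h1
    omega
  refine ⟨g i / D * (w i * m + u i), hpos, ?_⟩
  rw [← hsucc, Nat.Coprime.card_divisors_mul (hcop j hj _ (Nat.div_dvd_of_dvd hDj)),
    Nat.Coprime.card_divisors_mul (hcop i hi _ (Nat.div_dvd_of_dvd hDi)), ← heq]
  have hcard : ∀ n : ℕ, n ≠ 0 → (n.divisors.card : ℝ) ≠ 0 := fun n hn =>
    Nat.cast_ne_zero.2 (Finset.card_pos.2 ⟨1, by simp [hn]⟩).ne'
  have hr : ((g j / D).divisors.card : ℝ) * (B ^ s).divisors.card =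
      (g i / D).divisors.card * (A ^ s).divisors.card := by exact_mod_cast hratio
  have h1 := hcard _ (left_ne_zero_of_mul hpos.ne')
  have h2 := hcard _ (right_ne_zero_of_mul hpos.ne')
  have h3 := hcard _ (pow_ne_zero s hB)
  have h4 : ((g j / D).divisors.card * (w i * m + u i).divisors.card : ℕ) /
      (((g i / D).divisors.card * (w i * m + u i).divisors.card : ℕ) : ℝ) =
        ((A ^ s).divisors.card : ℝ) / (B ^ s).divisors.card := by
    push_cast
    rw [mul_div_mul_right _ _ h2, div_eq_div_iff h1 h3, hr, mul_comm]
  rw [h4]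
  exact hs s hs1

/-- The sequence of ratios `d(n+1)/d(n)`, over positive integers `n`, is dense
in `(0, ∞)`: every positive real number is a limit point (accumulation point)
of the set `{d(n+1)/d(n) : n a positive integer}`. -/
theorem stmt_1 (x : ℝ) (hx : 0 < x) :
    AccPt x (Filter.principal
      {r : ℝ | ∃ n : ℕ, 0 < n ∧ r = (d (n + 1) : ℝ) / (d n : ℝ)}) := by
  rw [accPt_iff_nhds]
  intro U hU
  obtain ⟨δ, hδ, hball⟩ := Metric.mem_nhds_iff.1 hU
  obtain ⟨n, hn, hlt⟩ := exists_abs_card_divisors_div_sub_lt (x := x + δ / 2) (ε := δ / 4)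
    (by linarith) (by linarith)
  have h1 := abs_lt.1 hlt
  refine ⟨_, ⟨hball ?_, n, hn, rfl⟩, ?_⟩
  · rw [Metric.mem_ball, Real.dist_eq, abs_lt]
    unfold d
    constructor <;> linarith
  · intro h
    unfold d at h
    linarith
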